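/- arXiv:2207.05540 — 9 statements merged into one kernel-verified Lean document; each statement's English description precedes it below -/
import Mathlib

section
/- Let d ∈ ℕ and let φ be a linear functional on the free algebra ℂ⟨x₁,…,x_d⟩ with φ(1) = 1 (normalized) and φ(xᵢ) = 0 for all i ∈ {1,…,d} (centralized). Set Q_{ij} = φ(xᵢxⱼ). Then for every polynomial p ∈ ℂ⟨x₁,…,x_d⟩, the n-fold convolution power φ^{⋆n} applied to the rescaled polynomial p(x₁/√n, …, x_d/√n) converges, as n → ∞, to γ_Q(p), where γ_Q is the gaussian functional with covariance matrix Q. -/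
/-!
Algebraic central limit theorem of Giri–von Waldenfels on the free algebra
ℂ⟨x₁,…,x_d⟩ = `FreeAlgebra ℂ (Fin d)`.
-/

open scoped TensorProduct

noncomputable section

/-- The free (noncommutative polynomial) algebra ℂ⟨x₁,…,x_d⟩. -/
abbrev FA (d : ℕ) := FreeAlgebra ℂ (Fin d)

/-- The comultiplication Δ, the algebra homomorphism with Δxᵢ = xᵢ⊗1 + 1⊗xᵢ. -/
def comulFA (d : ℕ) : FA d →ₐ[ℂ] (FA d ⊗[ℂ] FA d) :=
  FreeAlgebra.lift ℂ
    (fun i => FreeAlgebra.ι ℂ i ⊗ₜ[ℂ] (1 : FA d) + (1 : FA d) ⊗ₜ[ℂ] FreeAlgebra.ι ℂ i)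

/-- The counit δ, the algebra homomorphism with δ(xᵢ) = 0. -/
def counitFA (d : ℕ) : FA d →ₐ[ℂ] ℂ :=
  FreeAlgebra.lift ℂ (fun _ => (0 : ℂ))

/-- Convolution of linear functionals: φ⋆ψ = (φ⊗ψ)∘Δ. -/
def conv (d : ℕ) (φ ψ : FA d →ₗ[ℂ] ℂ) : FA d →ₗ[ℂ] ℂ :=
  (TensorProduct.lid ℂ ℂ).toLinearMap ∘ₗ TensorProduct.map φ ψ ∘ₗ (comulFA d).toLinearMap

/-- Convolution powers, with φ^{⋆0} = δ. -/
def convPow (d : ℕ) (φ : FA d →ₗ[ℂ] ℂ) : ℕ → (FA d →ₗ[ℂ] ℂ)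
  | 0 => (counitFA d).toLinearMap
  | (k + 1) => conv d (convPow d φ k) φ

/-- The monomial x_{w 0} ⋯ x_{w (n-1)} in the free algebra. -/
def word {d n : ℕ} (w : Fin n → Fin d) : FA d :=
  (List.ofFn (fun a => FreeAlgebra.ι ℂ (w a))).prod

/-- The gaussian moment Σ Q_{S₁}⋯Q_{S_k} of the monomial x_{w 0}⋯x_{w (n-1)}: the sum
over all pair partitions of {0,…,n-1}, encoded as fixed-point-free involutions `f`,
of the product of Q_{w a, w (f a)} over the pairs {a, f a} with a < f a.
(For `n` odd there are no such involutions and the sum is `0`.) -/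
def gaussMoment {d : ℕ} (Q : Matrix (Fin d) (Fin d) ℂ) {n : ℕ} (w : Fin n → Fin d) : ℂ :=
  ∑ f ∈ Finset.univ.filter
      (fun f : Equiv.Perm (Fin n) => (∀ a, f a ≠ a) ∧ ∀ a, f (f a) = a),
    ∏ a ∈ Finset.univ.filter (fun a : Fin n => a < f a), Q (w a) (w (f a))

/-- `γ` is the gaussian functional γ_Q with covariance matrix `Q`:  γ_Q(1) = 1 and the
moments of γ_Q are given by the pair-partition formula. -/
def IsGaussian {d : ℕ} (Q : Matrix (Fin d) (Fin d) ℂ) (γ : FA d →ₗ[ℂ] ℂ) : Prop :=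
  γ 1 = 1 ∧ ∀ (n : ℕ) (w : Fin n → Fin d), γ (word w) = gaussMoment Q w

/-- The algebra endomorphism sending each xᵢ to c·xᵢ;  for c = 1/√n it sends
p(x₁,…,x_d) to p(x₁/√n,…,x_d/√n). -/
def rescale (d : ℕ) (c : ℂ) : FA d →ₐ[ℂ] FA d :=
  FreeAlgebra.lift ℂ (fun i => c • FreeAlgebra.ι ℂ i)

/-- The powers of a set function `F` on finsets under the subset convolution
`(c ⋆ F) S = ∑ T ⊆ S, c T * F (S \ T)`. -/
def subsetConvPow {α : Type*} [DecidableEq α] (F : Finset α → ℂ) : ℕ → Finset α → ℂ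
  | 0, S => if S = ∅ then 1 else 0
  | n + 1, S => ∑ T ∈ S.powerset, subsetConvPow F n T * F (S \ T)

/-- Expanding a subset convolution power along the factor that contains a given element. -/
theorem subsetConvPow_insert {α : Type*} [DecidableEq α] (F : Finset α → ℂ) (n : ℕ)
    {a : α} {S : Finset α} (ha : a ∉ S) :
    subsetConvPow F (n + 1) (insert a S) =
      (n + 1) * ∑ U ∈ S.powerset, F (insert a U) * subsetConvPow F n (S \ U) := by
  induction n generalizing S with
  | zero =>
    rw [subsetConvPow, Finset.sum_powerset_insert ha]
    have h1 : ∀ T ∈ S.powerset,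
        subsetConvPow F 0 (insert a T) * F (insert a S \ insert a T) = 0 := by
      intro T _
      simp [subsetConvPow]
    rw [Finset.sum_eq_zero h1, Finset.sum_eq_single ∅, Finset.sum_eq_single S]
    · simp [subsetConvPow]
    · intro U hU hne
      have : ¬ S ⊆ U := fun h => hne (Finset.Subset.antisymm (Finset.mem_powerset.1 hU) h)
      simp [subsetConvPow, Finset.sdiff_eq_empty_iff_subset, this]
    · simp
    · intro T _ hne
      simp [subsetConvPow, hne]
    · simp
  | succ n ih =>
    have hflip : ∑ T ∈ S.powerset, subsetConvPow F (n + 1) T * F (insert a S \ T) =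
        ∑ U ∈ S.powerset, F (insert a U) * subsetConvPow F (n + 1) (S \ U) := by
      refine Finset.sum_nbij' (fun T => S \ T) (fun T => S \ T) ?_ ?_ ?_ ?_ ?_
      · intro T _; simp
      · intro T _; simp
      · intro T hT; simp at hT ⊢; exact hT
      · intro T hT; simp at hT ⊢; exact hT
      · intro T hT
        have hT := Finset.mem_powerset.1 hT
        rw [Finset.insert_sdiff_of_notMem _ (fun h => ha (hT h)),
          Finset.sdiff_sdiff_eq_self hT, mul_comm]
    have hmain : ∑ T ∈ S.powerset, subsetConvPow F (n + 1) (insert a T) *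
          F (insert a S \ insert a T) =
        (n + 1) * ∑ U ∈ S.powerset, F (insert a U) * subsetConvPow F (n + 1) (S \ U) := by
      have h1 : ∀ T ∈ S.powerset, subsetConvPow F (n + 1) (insert a T) *
          F (insert a S \ insert a T) = (n + 1) * ∑ U ∈ T.powerset,
            F (insert a U) * (subsetConvPow F n (T \ U) * F (S \ T)) := by
        intro T hT
        have hT := Finset.mem_powerset.1 hT
        rw [ih (fun h => ha (hT h)), mul_assoc, Finset.sum_mul,
          Finset.insert_sdiff_insert, Finset.sdiff_insert_of_notMem ha]
        simp only [mul_assoc]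
      rw [Finset.sum_congr rfl h1, ← Finset.mul_sum]
      congr 1
      simp only [subsetConvPow, Finset.mul_sum]
      rw [Finset.sum_sigma', Finset.sum_sigma']
      refine Finset.sum_nbij' (fun x => ⟨x.2, x.1 \ x.2⟩) (fun x => ⟨x.1 ∪ x.2, x.1⟩) ?_ ?_ ?_ ?_ ?_
      · rintro ⟨T, U⟩ h
        simp only [Finset.mem_sigma, Finset.mem_powerset] at h ⊢
        exact ⟨h.2.trans h.1, Finset.sdiff_subset_sdiff h.1 le_rfl⟩
      · rintro ⟨U, V⟩ h
        simp only [Finset.mem_sigma, Finset.mem_powerset] at h ⊢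
        exact ⟨Finset.union_subset h.1 (h.2.trans Finset.sdiff_subset), Finset.subset_union_left⟩
      · rintro ⟨T, U⟩ h
        simp only [Finset.mem_sigma, Finset.mem_powerset] at h ⊢
        rw [Finset.union_sdiff_of_subset h.2]
      · rintro ⟨U, V⟩ h
        simp only [Finset.mem_sigma, Finset.mem_powerset] at h ⊢
        rw [Finset.union_sdiff_cancel_left]
        exact (Finset.disjoint_sdiff.mono_right h.2)
      · rintro ⟨T, U⟩ h
        simp only [Finset.mem_sigma, Finset.mem_powerset] at h ⊢
        rw [sdiff_sdiff_left, Finset.sup_eq_union, Finset.union_sdiff_of_subset h.2]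
    rw [subsetConvPow, Finset.sum_powerset_insert ha, hflip, hmain]
    push_cast
    ring

open Filter Topology in
theorem tendsto_inv_sqrt_succ_mul_sqrt :
    Tendsto (fun n : ℕ => ((Real.sqrt ((n + 1 : ℕ) : ℝ) : ℂ))⁻¹ * (Real.sqrt n : ℂ))
      atTop (𝓝 1) := by
  have h : Tendsto (fun n : ℕ => Real.sqrt ((n : ℝ) / ((n : ℝ) + 1))) atTop (𝓝 1) := by
    have h := (Real.continuous_sqrt.tendsto 1).comp (tendsto_natCast_div_add_atTop (1 : ℝ))
    rwa [Real.sqrt_one] at h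
  have h2 := (Complex.continuous_ofReal.tendsto 1).comp h
  simp only [Complex.ofReal_one] at h2
  refine h2.congr fun n => ?_
  simp only [Function.comp_apply]
  rw [Real.sqrt_div (by positivity)]
  push_cast
  rw [div_eq_mul_inv, mul_comm]

open Filter Topology in
theorem tendsto_inv_sqrt_succ :
    Tendsto (fun n : ℕ => ((Real.sqrt ((n + 1 : ℕ) : ℝ) : ℂ))⁻¹) atTop (𝓝 0) := by
  have h : Tendsto (fun n : ℕ => (Real.sqrt ((n + 1 : ℕ) : ℝ))⁻¹) atTop (𝓝 0) :=
    tendsto_inv_atTop_zero.comp (Real.tendsto_sqrt_atTop.comp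
      (tendsto_natCast_atTop_atTop.comp (tendsto_add_atTop_nat 1)))
  have h2 := (Complex.continuous_ofReal.tendsto 0).comp h
  rw [Complex.ofReal_zero] at h2
  exact h2.congr fun n => Complex.ofReal_inv _

open Filter Topology in
/-- Central limit theorem for subset convolution powers. -/
theorem tendsto_subsetConvPow {α : Type*} [LinearOrder α] {F g : Finset α → ℂ}
    (hF : ∀ a, F {a} = 0) (hg0 : g ∅ = 1)
    (hg : ∀ (a : α) (S : Finset α), (∀ b ∈ S, a < b) →
      g (insert a S) = ∑ b ∈ S, F {a, b} * g (S.erase b)) (hF0 : F ∅ = 1) (S : Finset α) :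
    Tendsto (fun n : ℕ => ((Real.sqrt n : ℂ))⁻¹ ^ S.card * subsetConvPow F n S)
      atTop (𝓝 (g S)) := by
  induction hk : S.card using Nat.strong_induction_on generalizing S with
  | _ k ih =>
    subst hk
    rcases S.eq_empty_or_nonempty with rfl | hne
    · have : ∀ n : ℕ, subsetConvPow F n ∅ = 1 := by
        intro n
        induction n with
        | zero => simp [subsetConvPow]
        | succ n ihn => simp [subsetConvPow, ihn, hF0]
      simp [this, hg0]
    obtain ⟨a, S', hmin, rfl⟩ : ∃ a S', (∀ b ∈ S', a < b) ∧ S = insert a S' := by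
      refine ⟨S.min' hne, S.erase (S.min' hne), ?_, ?_⟩
      · intro b hb
        exact S.min'_lt_of_mem_erase_min' hne hb
      · rw [Finset.insert_erase (S.min'_mem hne)]
    have ha : a ∉ S' := fun h => lt_irrefl _ (hmin a h)
    rw [← tendsto_add_atTop_iff_nat 1]
    set r : ℕ → ℂ := fun n => ((Real.sqrt ((n + 1 : ℕ) : ℝ) : ℂ))⁻¹ with hr
    have hr2 : ∀ n : ℕ, ((n : ℂ) + 1) * r n ^ 2 = 1 := by
      intro n
      have h0 : ((n : ℂ) + 1) ≠ 0 := by exact_mod_cast Nat.succ_ne_zero n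
      have : ((Real.sqrt ((n + 1 : ℕ) : ℝ) : ℂ)) ^ 2 = (n : ℂ) + 1 := by
        rw [← Complex.ofReal_pow, Real.sq_sqrt (by positivity)]
        push_cast
        rfl
      simp only [hr, inv_pow, this]
      exact mul_inv_cancel₀ h0
    have hexp : ∀ n : ℕ, r n ^ (insert a S').card * subsetConvPow F (n + 1) (insert a S') =
        ∑ U ∈ S'.powerset, F (insert a U) * (((n : ℂ) + 1) * r n ^ (U.card + 1)) *
          (r n ^ (S' \ U).card * subsetConvPow F n (S' \ U)) := by
      intro n
      rw [subsetConvPow_insert F n ha, Finset.card_insert_of_notMem ha, Finset.mul_sum,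
        Finset.mul_sum]
      refine Finset.sum_congr rfl fun U hU => ?_
      rw [← Finset.card_sdiff_add_card_eq_card (Finset.mem_powerset.1 hU)]
      ring
    have hshift : ∀ V ⊆ S', Tendsto (fun n : ℕ => r n ^ V.card * subsetConvPow F n V)
        atTop (𝓝 (g V)) := by
      intro V hV
      have hlt : V.card < (insert a S').card := by
        rw [Finset.card_insert_of_notMem ha]
        exact Nat.lt_succ_of_le (Finset.card_le_card hV)
      have h := (tendsto_inv_sqrt_succ_mul_sqrt.pow V.card).mul (ih _ hlt V rfl)
      rw [one_pow, one_mul] at h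
      refine h.congr' ?_
      filter_upwards [eventually_gt_atTop 0] with n hn
      have h0 : (Real.sqrt n : ℂ) ≠ 0 := by
        rw [Complex.ofReal_ne_zero]
        positivity
      rw [← mul_assoc, ← mul_pow, mul_assoc, mul_inv_cancel₀ h0, mul_one]
    have hlim : Tendsto (fun n : ℕ => r n ^ (insert a S').card *
        subsetConvPow F (n + 1) (insert a S')) atTop
        (𝓝 (∑ U ∈ S'.powerset, if U.card = 1 then F (insert a U) * g (S' \ U) else 0)) := by
      simp only [hexp]
      refine tendsto_finsetSum _ fun U hU => ?_
      have hV := hshift (S' \ U) Finset.sdiff_subset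
      rcases hc : U.card with _ | _ | k
      · rw [Finset.card_eq_zero] at hc
        subst hc
        simp [hF]
      · simp only [zero_add, one_add_one_eq_two, hr2, mul_one, if_true]
        exact hV.const_mul _
      · have h1 : ∀ n : ℕ, ((n : ℂ) + 1) * r n ^ (k + 1 + 1 + 1) = r n ^ (k + 1) := by
          intro n
          rw [show k + 1 + 1 + 1 = 2 + (k + 1) by ring, pow_add, ← mul_assoc, hr2, one_mul]
        simp only [h1]
        have h2 := ((tendsto_inv_sqrt_succ.pow (k + 1)).const_mul (F (insert a U))).mul hV
        rw [zero_pow k.succ_ne_zero, mul_zero, zero_mul] at h2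
        simpa only [Nat.add_eq_right, Nat.add_eq_zero_iff, one_ne_zero, and_false,
          if_false] using h2
    convert hlim using 2
    rw [hg a S' hmin, ← Finset.sum_filter, ← Finset.powersetCard_eq_filter,
      Finset.powersetCard_one, Finset.sum_map]
    refine Finset.sum_congr rfl fun b hb => ?_
    simp [Finset.sdiff_singleton_eq_erase]

/-- The sum over all pair partitions of the finset `S`, encoded as involutions whose set of
non-fixed points is `S`, of the product of `q` over the pairs. -/
def pairingSum {α : Type*} [LinearOrder α] [Fintype α] (q : α → α → ℂ) (S : Finset α) : ℂ :=
  ∑ f ∈ Finset.univ.filter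
      (fun f : Equiv.Perm α => (∀ a, f a ≠ a ↔ a ∈ S) ∧ ∀ a, f (f a) = a),
    ∏ a ∈ Finset.univ.filter (fun a : α => a < f a), q a (f a)

theorem pairingSum_empty {α : Type*} [LinearOrder α] [Fintype α] (q : α → α → ℂ) :
    pairingSum q ∅ = 1 := by
  have : Finset.univ.filter
      (fun f : Equiv.Perm α => (∀ a, f a ≠ a ↔ a ∈ (∅ : Finset α)) ∧ ∀ a, f (f a) = a) = {1} := by
    ext f
    simp only [Finset.mem_filter, Finset.mem_univ, true_and, Finset.mem_singleton,
      Finset.notMem_empty, iff_false, not_not]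
    constructor
    · rintro ⟨h, -⟩
      exact Equiv.ext h
    · rintro rfl
      simp
  rw [pairingSum, this]
  simp

/-- Expansion of the pairing sum along the partner of the smallest element. -/
theorem pairingSum_insert {α : Type*} [LinearOrder α] [Fintype α] (q : α → α → ℂ)
    (a : α) (S : Finset α) (hmin : ∀ b ∈ S, a < b) :
    pairingSum q (insert a S) = ∑ b ∈ S, q a b * pairingSum q (S.erase b) := by
  have ha : a ∉ S := fun h => lt_irrefl _ (hmin a h)
  unfold pairingSum
  rw [← Finset.sum_fiberwise_of_maps_to (t := S) (g := fun f : Equiv.Perm α => f a)]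
  · refine Finset.sum_congr rfl fun b hb => ?_
    have hab : a < b := hmin b hb
    rw [Finset.mul_sum]
    refine Finset.sum_nbij' (fun f => Equiv.swap a b * f) (fun f => Equiv.swap a b * f)
      ?_ ?_ ?_ ?_ ?_
    · intro f hf
      simp only [Finset.mem_filter, Finset.mem_univ, true_and] at hf ⊢
      obtain ⟨⟨hS, hinv⟩, hfa⟩ := hf
      have hfb : f b = a := by rw [← hfa, hinv]
      have hx : ∀ x, x ≠ a → x ≠ b → f x ≠ a ∧ f x ≠ b := by
        intro x h1 h2
        refine ⟨fun h => h2 ?_, fun h => h1 ?_⟩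
        · rw [← hinv x, h, hfa]
        · rw [← hinv x, h, hfb]
      have key : ∀ x, x ≠ a → x ≠ b → (Equiv.swap a b * f) x = f x := fun x h1 h2 =>
        Equiv.swap_apply_of_ne_of_ne (hx x h1 h2).1 (hx x h1 h2).2
      have keya : (Equiv.swap a b * f) a = a := by simp [hfa]
      have keyb : (Equiv.swap a b * f) b = b := by simp [hfb]
      constructor
      · intro x
        by_cases h1 : x = a
        · subst h1; rw [keya]; simp [ha]
        by_cases h2 : x = b
        · subst h2; rw [keyb]; simp
        rw [key x h1 h2, hS]
        simp [h1, h2]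
      · intro x
        by_cases h1 : x = a
        · subst h1; rw [keya, keya]
        by_cases h2 : x = b
        · subst h2; rw [keyb, keyb]
        rw [key x h1 h2, key _ (hx x h1 h2).1 (hx x h1 h2).2, hinv]
    · intro f hf
      simp only [Finset.mem_filter, Finset.mem_univ, true_and] at hf ⊢
      obtain ⟨hS, hinv⟩ := hf
      have hfa : f a = a := by
        by_contra h
        exact ha (Finset.mem_of_mem_erase ((hS a).1 h))
      have hfb : f b = b := by
        by_contra h
        exact Finset.notMem_erase b S ((hS b).1 h)
      have hx : ∀ x, x ≠ a → x ≠ b → f x ≠ a ∧ f x ≠ b := by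
        intro x h1 h2
        exact ⟨fun h => h1 (f.injective (h.trans hfa.symm)),
          fun h => h2 (f.injective (h.trans hfb.symm))⟩
      have key : ∀ x, x ≠ a → x ≠ b → (Equiv.swap a b * f) x = f x := fun x h1 h2 =>
        Equiv.swap_apply_of_ne_of_ne (hx x h1 h2).1 (hx x h1 h2).2
      have keya : (Equiv.swap a b * f) a = b := by simp [hfa]
      have keyb : (Equiv.swap a b * f) b = a := by simp [hfb]
      refine ⟨⟨?_, ?_⟩, keya⟩
      · intro x
        by_cases h1 : x = a
        · subst h1; rw [keya]; simp [hab.ne']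
        by_cases h2 : x = b
        · subst h2; rw [keyb]; simp [hab.ne, hb]
        rw [key x h1 h2, hS]
        simp [h1, h2]
      · intro x
        by_cases h1 : x = a
        · subst h1; rw [keya, keyb]
        by_cases h2 : x = b
        · subst h2; rw [keyb, keya]
        rw [key x h1 h2, key _ (hx x h1 h2).1 (hx x h1 h2).2, hinv]
    · intro f _; simp [← mul_assoc]
    · intro f _; simp [← mul_assoc]
    · intro f hf
      simp only [Finset.mem_filter, Finset.mem_univ, true_and] at hf
      obtain ⟨⟨hS, hinv⟩, hfa⟩ := hf
      have hfb : f b = a := by rw [← hfa, hinv]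
      have hx : ∀ x, x ≠ a → x ≠ b → f x ≠ a ∧ f x ≠ b := by
        intro x h1 h2
        refine ⟨fun h => h2 ?_, fun h => h1 ?_⟩
        · rw [← hinv x, h, hfa]
        · rw [← hinv x, h, hfb]
      have key : ∀ x, x ≠ a → x ≠ b → (Equiv.swap a b * f) x = f x := fun x h1 h2 =>
        Equiv.swap_apply_of_ne_of_ne (hx x h1 h2).1 (hx x h1 h2).2
      have hfilter : Finset.univ.filter (fun x : α => x < f x) =
          insert a (Finset.univ.filter (fun x : α => x < (Equiv.swap a b * f) x)) := by
        ext x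
        simp only [Finset.mem_filter, Finset.mem_univ, true_and, Finset.mem_insert]
        by_cases h1 : x = a
        · subst h1; simp [hfa, hab]
        by_cases h2 : x = b
        · subst h2; simp [hfb, h1, hab.le]
        rw [key x h1 h2]
        simp [h1]
      rw [hfilter, Finset.prod_insert
        (fun h => by simpa [hfa] using (Finset.mem_filter.1 h).2), hfa]
      congr 1
      refine Finset.prod_congr rfl fun x hxm => ?_
      simp only [Finset.mem_filter, Finset.mem_univ, true_and] at hxm
      rw [key x]
      · rintro rfl; simp [hfa] at hxm
      · rintro rfl; simp [hfb] at hxm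
  · intro f hf
    simp only [Finset.mem_filter, Finset.mem_univ, true_and] at hf
    have h1 : f a ≠ a := (hf.1 a).2 (Finset.mem_insert_self _ _)
    have h2 : f (f a) ≠ f a := by rw [hf.2]; exact h1.symm
    exact (Finset.mem_insert.1 ((hf.1 _).1 h2)).resolve_left h1

theorem gaussMoment_eq_pairingSum {d : ℕ} (Q : Matrix (Fin d) (Fin d) ℂ) {n : ℕ}
    (w : Fin n → Fin d) :
    gaussMoment Q w = pairingSum (fun a b => Q (w a) (w b)) Finset.univ := by
  simp [gaussMoment, pairingSum]

/-- The subword of `x_{w 0} ⋯ x_{w (n-1)}` on the positions in `S`. -/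
def subword {d n : ℕ} (w : Fin n → Fin d) (S : Finset (Fin n)) : FA d :=
  (S.sort.map (fun a => FreeAlgebra.ι ℂ (w a))).prod

theorem subword_empty {d n : ℕ} (w : Fin n → Fin d) : subword w ∅ = 1 := by
  simp [subword]

theorem subword_insert {d n : ℕ} (w : Fin n → Fin d) {a : Fin n} {S : Finset (Fin n)}
    (h : ∀ b ∈ S, a < b) : subword w (insert a S) = FreeAlgebra.ι ℂ (w a) * subword w S := by
  rw [subword, Finset.sort_insert _ (fun b hb => (h b hb).le) (fun ha => lt_irrefl _ (h a ha))]
  simp [subword]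

theorem subword_singleton {d n : ℕ} (w : Fin n → Fin d) (a : Fin n) :
    subword w {a} = FreeAlgebra.ι ℂ (w a) := by
  simp [subword]

theorem subword_univ {d n : ℕ} (w : Fin n → Fin d) : subword w Finset.univ = word w := by
  rw [subword, word, Fin.sort_univ, List.ofFn_eq_map]

theorem comulFA_subword {d n : ℕ} (w : Fin n → Fin d) (S : Finset (Fin n)) :
    comulFA d (subword w S) =
      ∑ T ∈ S.powerset, subword w T ⊗ₜ[ℂ] subword w (S \ T) := by
  induction S using Finset.induction_on_min with
  | empty => simp [subword_empty, Algebra.TensorProduct.one_def]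
  | insert a S hmin ih =>
    have ha : a ∉ S := fun h => lt_irrefl _ (hmin a h)
    rw [subword_insert w hmin, map_mul, ih, Finset.sum_powerset_insert ha, comulFA,
      FreeAlgebra.lift_ι_apply, add_mul, add_comm, Finset.mul_sum, Finset.mul_sum]
    congr 1
    · refine Finset.sum_congr rfl fun T hT => ?_
      have hT := Finset.mem_powerset.1 hT
      rw [Finset.insert_sdiff_of_notMem _ (fun h => ha (hT h)),
        subword_insert w (fun b hb => hmin b (Finset.sdiff_subset hb)),
        Algebra.TensorProduct.tmul_mul_tmul, one_mul]
    · refine Finset.sum_congr rfl fun T hT => ?_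
      have hT := Finset.mem_powerset.1 hT
      rw [Finset.insert_sdiff_insert, Finset.sdiff_insert_of_notMem ha,
        subword_insert w (fun b hb => hmin b (hT hb)),
        Algebra.TensorProduct.tmul_mul_tmul, one_mul]

theorem convPow_subword {d m : ℕ} (φ : FA d →ₗ[ℂ] ℂ) (w : Fin m → Fin d) (n : ℕ)
    (S : Finset (Fin m)) :
    convPow d φ n (subword w S) = subsetConvPow (fun T => φ (subword w T)) n S := by
  induction n generalizing S with
  | zero =>
    induction S using Finset.induction_on_min with
    | empty => simp [convPow, subsetConvPow, subword_empty]
    | insert a S hmin ih => simp [convPow, subsetConvPow, subword_insert w hmin, counitFA]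
  | succ n ih =>
    simp [convPow, conv, subsetConvPow, comulFA_subword, ih]

theorem rescale_word {d n : ℕ} (c : ℂ) (w : Fin n → Fin d) :
    rescale d c (word w) = c ^ n • word w := by
  induction n with
  | zero => simp [word]
  | succ n ih =>
    have h : word w = FreeAlgebra.ι ℂ (w 0) * word (fun i => w i.succ) := by
      simp [word, List.ofFn_succ]
    rw [h, map_mul, ih, rescale, FreeAlgebra.lift_ι_apply, smul_mul_smul_comm, pow_succ']

/-- The free algebra is spanned by the monomials. -/
theorem span_words (d : ℕ) :
    Submodule.span ℂ {p : FA d | ∃ (n : ℕ) (w : Fin n → Fin d), p = word w} = ⊤ := by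
  rw [eq_top_iff, ← Algebra.top_toSubmodule, ← FreeAlgebra.adjoin_range_ι,
    Algebra.adjoin_eq_span]
  refine Submodule.span_mono fun p hp => ?_
  obtain ⟨l, hl, rfl⟩ := Submonoid.exists_list_of_mem_closure hp
  obtain ⟨l, rfl⟩ : ∃ l' : List (Fin d), l = l'.map (FreeAlgebra.ι ℂ) := by
    have : l ∈ Set.range (List.map (FreeAlgebra.ι ℂ : Fin d → FA d)) := by
      rw [Set.range_list_map]
      exact hl
    obtain ⟨l', h⟩ := this
    exact ⟨l', h.symm⟩
  refine ⟨l.length, l.get, ?_⟩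
  rw [word]
  congr 1
  exact (congrArg _ (List.ofFn_get l).symm).trans List.map_ofFn

/-- **Algebraic central limit theorem** (Giri–von Waldenfels).  If φ is a normalized
(φ(1) = 1) and centralized (φ(xᵢ) = 0) linear functional on ℂ⟨x₁,…,x_d⟩ and
Q_{ij} = φ(xᵢxⱼ), then for every polynomial p the values φ^{⋆n}(p(x₁/√n,…,x_d/√n))
converge, as n → ∞, to γ_Q(p). -/
theorem algebraic_central_limit_theorem (d : ℕ) (φ : FA d →ₗ[ℂ] ℂ)
    (hφ1 : φ 1 = 1) (hφc : ∀ i : Fin d, φ (FreeAlgebra.ι ℂ i) = 0)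
    (γ : FA d →ₗ[ℂ] ℂ)
    (hγ : IsGaussian (fun i j => φ (FreeAlgebra.ι ℂ i * FreeAlgebra.ι ℂ j)) γ)
    (p : FA d) :
    Filter.Tendsto
      (fun n : ℕ => convPow d φ n (rescale d ((Real.sqrt n : ℂ))⁻¹ p))
      Filter.atTop (nhds (γ p)) := by
  have hp : p ∈ Submodule.span ℂ {p : FA d | ∃ (n : ℕ) (w : Fin n → Fin d), p = word w} := by
    rw [span_words]
    trivial
  induction hp using Submodule.span_induction with
  | mem p hp =>
    obtain ⟨m, w, rfl⟩ := hp
    rw [hγ.2 m w]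
    refine (gaussMoment_eq_pairingSum _ w).symm ▸ ?_
    have h := tendsto_subsetConvPow (F := fun T => φ (subword w T))
      (g := pairingSum fun a b => φ (FreeAlgebra.ι ℂ (w a) * FreeAlgebra.ι ℂ (w b)))
      (fun a => by simp [subword_singleton, hφc]) (pairingSum_empty _)
      (fun a S hmin => by
        rw [pairingSum_insert _ a S hmin]
        refine Finset.sum_congr rfl fun b hb => ?_
        rw [subword_insert w (by simpa using hmin b hb), subword_singleton])
      (by simp [subword_empty, hφ1]) Finset.univ
    refine h.congr fun n => ?_
    rw [rescale_word, map_smul, smul_eq_mul, ← subword_univ, convPow_subword,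
      Finset.card_univ, Fintype.card_fin]
  | zero => simp
  | add p q _ _ hp hq => simpa using hp.add hq
  | smul c p _ hp => simpa using hp.const_mul c

end
end

section
/- Let d ∈ ℕ and let Q be a complex d×d matrix. The gaussian functional γ_Q vanishes on the two-sided ideal in ℂ⟨x₁,…,x_d⟩ generated by the elements xᵢxⱼ − xⱼxᵢ − (Q_{ij} − Q_{ji})·1 for i, j ∈ {1,…,d}. -/
/-!
The gaussian functional γ_Q on ℂ⟨x₁,…,x_d⟩ vanishes on the two-sided ideal generated by
the elements xᵢxⱼ − xⱼxᵢ − (Q_{ij} − Q_{ji})·1.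
-/

noncomputable section

section PairMoment

variable {α β ι R : Type*} [CommRing R]

/-- Fixed-point-free involutions, which encode pair partitions. -/
def IsPairing (f : Equiv.Perm α) : Prop := (∀ a, f a ≠ a) ∧ ∀ a, f (f a) = a

instance [Fintype α] [DecidableEq α] (f : Equiv.Perm α) : Decidable (IsPairing f) :=
  inferInstanceAs (Decidable (_ ∧ _))

lemma IsPairing.permCongr_iff (e : α ≃ β) (f : Equiv.Perm α) :
    IsPairing (e.permCongr f) ↔ IsPairing f := by
  constructor
  · rintro ⟨h₁, h₂⟩
    exact ⟨fun a h ↦ h₁ (e a) (by simp [h]), fun a ↦ by simpa using h₂ (e a)⟩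
  · rintro ⟨h₁, h₂⟩
    exact ⟨fun a h ↦ h₁ (e.symm a) (by simpa [Equiv.eq_symm_apply] using h), fun a ↦ by simp [h₂]⟩

lemma IsPairing.ne_and_ne_iff {f : Equiv.Perm α} (hf : IsPairing f) {p q : α} (hfp : f p = q)
    (a : α) : (f a ≠ p ∧ f a ≠ q) ↔ (a ≠ p ∧ a ≠ q) := by
  have hfq : f q = p := by rw [← hfp, hf.2]
  rw [← hfp, f.injective.ne_iff, hfp, ← f.injective.ne_iff (x := a) (y := q), hfq]
  have : f a ≠ p ↔ a ≠ q := by rw [← hfq, f.injective.ne_iff]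
  tauto

lemma swap_lt_swap_iff [LinearOrder α] {p q a b : α} (hpq : p ⋖ q) (h₁ : ¬ (a = p ∧ b = q))
    (h₂ : ¬ (a = q ∧ b = p)) : Equiv.swap p q a < Equiv.swap p q b ↔ a < b := by
  have hlt := hpq.lt
  have hle : ∀ c, p < c ↔ q ≤ c := fun c ↦ ⟨hpq.ge_of_gt, hlt.trans_le⟩
  have hle' : ∀ c, c < q ↔ c ≤ p := fun c ↦ ⟨hpq.le_of_lt, fun h ↦ h.trans_lt hlt⟩
  simp only [Equiv.swap_apply_def]
  grind

lemma isPairing_ofSubtype_mul_swap [DecidableEq α] {p q : α} (hpq : p ≠ q)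
    {g : Equiv.Perm {a // a ≠ p ∧ a ≠ q}} (hg : IsPairing g) :
    IsPairing (Equiv.Perm.ofSubtype g * Equiv.swap p q) := by
  have h₁ : Equiv.Perm.ofSubtype g p = p := Equiv.Perm.ofSubtype_apply_of_not_mem g (by simp)
  have h₂ : Equiv.Perm.ofSubtype g q = q := Equiv.Perm.ofSubtype_apply_of_not_mem g (by simp)
  have h₃ (a : {a // a ≠ p ∧ a ≠ q}) :
      (Equiv.Perm.ofSubtype g * Equiv.swap p q) a = (g a : α) := by
    rw [Equiv.Perm.mul_apply, Equiv.swap_apply_of_ne_of_ne a.2.1 a.2.2,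
      Equiv.Perm.ofSubtype_apply_coe]
  refine ⟨fun a ↦ ?_, fun a ↦ ?_⟩
  all_goals
    by_cases ha : a ≠ p ∧ a ≠ q
    · lift a to {a // a ≠ p ∧ a ≠ q} using ha
      simp only [h₃, hg.2, ne_eq, Subtype.coe_inj, hg.1, not_false_eq_true]
    · obtain rfl | rfl : a = p ∨ a = q := by tauto
      all_goals simp [h₁, h₂, hpq, hpq.symm]

variable [Fintype α] [LinearOrder α] [Fintype β] [LinearOrder β]

/-- The product of `Q (w a) (w (f a))` over the pairs `{a, f a}` with `a < f a`. -/
def pairWeight (Q : Matrix ι ι R) (w : α → ι) (f : Equiv.Perm α) : R :=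
  ∏ a with a < f a, Q (w a) (w (f a))

/-- The sum over all pair partitions of a finite linear order of their weights. -/
def pairMoment (Q : Matrix ι ι R) (w : α → ι) : R :=
  ∑ f : Equiv.Perm α with IsPairing f, pairWeight Q w f

lemma pairWeight_permCongr (Q : Matrix ι ι R) (w : β → ι) (e : α ≃ β) (f : Equiv.Perm α)
    (h : ∀ a, e a < e (f a) ↔ a < f a) :
    pairWeight Q w (e.permCongr f) = pairWeight Q (w ∘ e) f := by
  refine (Finset.prod_equiv e ?_ ?_).symm
  · intro a
    rw [Finset.mem_filter_univ, Finset.mem_filter_univ, Equiv.permCongr_apply,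
      Equiv.symm_apply_apply, h]
  · intro a _
    simp

lemma pairMoment_comp_orderIso (Q : Matrix ι ι R) (w : β → ι) (e : α ≃o β) :
    pairMoment Q (w ∘ e) = pairMoment Q w := by
  refine Finset.sum_equiv e.toEquiv.permCongr ?_ ?_
  · intro f
    simp [IsPairing.permCongr_iff]
  · intro f _
    exact (pairWeight_permCongr Q w e.toEquiv f (fun a ↦ e.lt_iff_lt)).symm

lemma sum_pairWeight_comp_swap (Q : Matrix ι ι R) (w : α → ι) {p q : α} (hpq : p ⋖ q) :
    ∑ f : Equiv.Perm α with IsPairing f ∧ f p ≠ q, pairWeight Q (w ∘ Equiv.swap p q) f =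
      ∑ f : Equiv.Perm α with IsPairing f ∧ f p ≠ q, pairWeight Q w f := by
  have key : ∀ f : Equiv.Perm α, IsPairing f → (f q = p ↔ f p = q) := fun f hf ↦
    ⟨fun h ↦ by rw [← h, hf.2], fun h ↦ by rw [← h, hf.2]⟩
  refine Finset.sum_equiv (Equiv.swap p q).permCongr ?_ ?_
  · intro f
    simp only [Finset.mem_filter, Finset.mem_univ, true_and, IsPairing.permCongr_iff]
    refine and_congr_right fun hf ↦ not_congr ?_
    rw [Equiv.permCongr_apply, Equiv.symm_swap, Equiv.swap_apply_left, ← key f hf,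
      Equiv.swap_apply_eq_iff, Equiv.swap_apply_right]
  · intro f hf
    simp only [Finset.mem_filter, Finset.mem_univ, true_and] at hf
    refine (pairWeight_permCongr Q w _ f fun a ↦ swap_lt_swap_iff hpq ?_ ?_).symm
    · rintro ⟨rfl, h⟩
      exact hf.2 h
    · rintro ⟨rfl, h⟩
      exact hf.2 ((key f hf.1).1 h)

lemma sum_pairWeight_of_apply_eq (Q : Matrix ι ι R) (w : α → ι) {p q : α} (hpq : p < q) :
    ∑ f : Equiv.Perm α with IsPairing f ∧ f p = q, pairWeight Q w f =
      Q (w p) (w q) * pairMoment Q (fun a : {a // a ≠ p ∧ a ≠ q} ↦ w a) := by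
  rw [pairMoment, Finset.mul_sum]
  refine Finset.sum_bij'
    (fun f hf ↦ f.subtypePerm (p := fun a ↦ a ≠ p ∧ a ≠ q) fun a ↦
      IsPairing.ne_and_ne_iff (Finset.mem_filter.1 hf).2.1 (Finset.mem_filter.1 hf).2.2 a)
    (fun g _ ↦ Equiv.Perm.ofSubtype g * Equiv.swap p q) ?_ ?_ ?_ ?_ ?_
  · intro f hf
    simp only [Finset.mem_filter, Finset.mem_univ, true_and] at hf ⊢
    exact ⟨fun a h ↦ hf.1.1 a (congrArg Subtype.val h), fun a ↦ Subtype.ext (hf.1.2 a)⟩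
  · intro g hg
    simp only [Finset.mem_filter, Finset.mem_univ, true_and] at hg ⊢
    exact ⟨isPairing_ofSubtype_mul_swap hpq.ne hg, by simp [Equiv.Perm.ofSubtype_apply_of_not_mem]⟩
  · intro f hf
    simp only [Finset.mem_filter, Finset.mem_univ, true_and] at hf
    ext a
    by_cases ha : a ≠ p ∧ a ≠ q
    · simp [Equiv.swap_apply_of_ne_of_ne ha.1 ha.2, Equiv.Perm.ofSubtype_apply_of_mem, ha]
    · have hfq : f q = p := by rw [← hf.2, hf.1.2]
      obtain rfl | rfl : a = p ∨ a = q := by tauto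
      · simp [Equiv.Perm.ofSubtype_apply_of_not_mem, hf.2]
      · simp [Equiv.Perm.ofSubtype_apply_of_not_mem, hfq]
  · intro g hg
    ext a
    simp [Equiv.swap_apply_of_ne_of_ne a.2.1 a.2.2]
  · intro f hf
    simp only [Finset.mem_filter, Finset.mem_univ, true_and] at hf
    have hfq : f q = p := by rw [← hf.2, hf.1.2]
    have hset : ({a | a < f a} : Finset α) = insert p
        (({a : {a // a ≠ p ∧ a ≠ q} | a.1 < f a} : Finset _).map (.subtype _)) := by
      ext a
      simp only [Finset.mem_filter_univ, Finset.mem_insert, Finset.mem_map,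
        Function.Embedding.subtype_apply, Subtype.exists, exists_and_left, exists_prop]
      grind
    rw [pairWeight, hset, Finset.prod_insert (by simp), Finset.prod_map]
    exact congrArg (fun x ↦ Q (w p) (w x) * _) hf.2

lemma pairMoment_sub_comp_swap (Q : Matrix ι ι R) (w : α → ι) {p q : α} (hpq : p ⋖ q) :
    pairMoment Q w - pairMoment Q (w ∘ Equiv.swap p q) =
      (Q (w p) (w q) - Q (w q) (w p)) *
        pairMoment Q (fun a : {a // a ≠ p ∧ a ≠ q} ↦ w a) := by
  have split (v : α → ι) : pairMoment Q v =
      ∑ f : Equiv.Perm α with IsPairing f ∧ f p = q, pairWeight Q v f +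
        ∑ f : Equiv.Perm α with IsPairing f ∧ f p ≠ q, pairWeight Q v f := by
    rw [pairMoment, ← Finset.sum_filter_add_sum_filter_not _ (fun f ↦ f p = q),
      Finset.filter_filter, Finset.filter_filter]
  have hrest : (fun a : {a // a ≠ p ∧ a ≠ q} ↦ (w ∘ Equiv.swap p q) a) =
      fun a : {a // a ≠ p ∧ a ≠ q} ↦ w a := by
    funext a
    simp [Equiv.swap_apply_of_ne_of_ne a.2.1 a.2.2]
  rw [split w, split (w ∘ _), sum_pairWeight_comp_swap Q w hpq,
    sum_pairWeight_of_apply_eq Q w hpq.lt, sum_pairWeight_of_apply_eq Q _ hpq.lt, hrest]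
  simp only [Function.comp_apply, Equiv.swap_apply_left, Equiv.swap_apply_right]
  ring

lemma pairMoment_get_append (Q : Matrix ι ι R) (u v : List ι) (i j : ι) :
    pairMoment Q (u ++ i :: j :: v).get - pairMoment Q (u ++ j :: i :: v).get =
      (Q i j - Q j i) * pairMoment Q (u ++ v).get := by
  let p : Fin (u ++ i :: j :: v).length := ⟨u.length, by simp⟩
  let q : Fin (u ++ i :: j :: v).length := ⟨u.length + 1, by simp⟩
  have hpq : p ⋖ q := by
    refine ⟨Nat.lt_succ_self _, fun c h₁ h₂ ↦ ?_⟩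
    simp only [p, q, Fin.lt_def] at h₁ h₂
    omega
  have hlen : (u ++ i :: j :: v).length = (u ++ j :: i :: v).length := by simp
  have hswap : (u ++ i :: j :: v).get ∘ Equiv.swap p q =
      (u ++ j :: i :: v).get ∘ Fin.castOrderIso hlen := by
    funext a
    simp only [Function.comp_apply, Equiv.swap_apply_def]
    split_ifs with h₁ h₂
    · simp [h₁, p, q]
    · simp [h₂, p, q]
    · simp only [p, q, Fin.ext_iff] at h₁ h₂
      simp only [List.get_eq_getElem, Fin.castOrderIso_apply, Fin.val_cast]
      grind
  let s : Fin (u ++ v).length → {a // a ≠ p ∧ a ≠ q} := fun k ↦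
    ⟨⟨if k < u.length then k else k + 2, by grind⟩, by simp only [p, q, ne_eq, Fin.ext_iff]; grind⟩
  have hs : StrictMono s := by
    intro a b hab
    simp only [s, Subtype.mk_lt_mk, Fin.lt_def] at hab ⊢
    grind
  have hs' : Function.Surjective s := by
    rintro ⟨a, ha⟩
    simp only [p, q, ne_eq, Fin.ext_iff] at ha
    have ha' := a.2
    simp only [List.length_append, List.length_cons] at ha'
    refine ⟨⟨if a < u.length then a else a - 2, by grind⟩, ?_⟩
    simp only [s, Subtype.mk.injEq, Fin.ext_iff]
    grind
  have hrest : (u ++ v).get =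
      (fun a : {a // a ≠ p ∧ a ≠ q} ↦ (u ++ i :: j :: v).get a) ∘
        StrictMono.orderIsoOfSurjective s hs hs' := by
    funext k
    simp only [Function.comp_apply, StrictMono.coe_orderIsoOfSurjective, s, List.get_eq_getElem]
    grind
  have h := pairMoment_sub_comp_swap Q (u ++ i :: j :: v).get hpq
  rw [hswap, pairMoment_comp_orderIso] at h
  rw [h, hrest, pairMoment_comp_orderIso]
  simp [p, q]

end PairMoment

lemma gaussMoment_eq_pairMoment {d n : ℕ} (Q : Matrix (Fin d) (Fin d) ℂ) (w : Fin n → Fin d) :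
    gaussMoment Q w = pairMoment Q w := by
  rw [gaussMoment, pairMoment]
  refine Finset.sum_congr ?_ fun _ _ ↦ rfl
  ext f
  rw [Finset.mem_filter, Finset.mem_filter]
  rfl

lemma word_get {d : ℕ} (l : List (Fin d)) :
    word l.get = (l.map (FreeAlgebra.ι ℂ)).prod := by
  rw [word, List.ofFn_comp' l.get (FreeAlgebra.ι ℂ), List.ofFn_get]

lemma mem_span_range_prod_map_ι {d : ℕ} (a : FA d) :
    a ∈ Submodule.span ℂ (Set.range fun l : List (Fin d) ↦ (l.map (FreeAlgebra.ι ℂ)).prod) := by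
  have ha : a ∈ Subalgebra.toSubmodule (Algebra.adjoin ℂ (Set.range (FreeAlgebra.ι ℂ))) := by
    rw [FreeAlgebra.adjoin_range_ι]
    trivial
  rw [Algebra.adjoin_eq_span] at ha
  refine Submodule.span_mono (fun x hx ↦ ?_) ha
  obtain ⟨l, hl, rfl⟩ := Submonoid.exists_list_of_mem_closure hx
  obtain ⟨l, rfl⟩ : l ∈ Set.range (List.map (FreeAlgebra.ι ℂ)) := by
    rw [Set.range_list_map]
    exact hl
  exact ⟨l, rfl⟩

/-- **(Giri–von Waldenfels.)**  The gaussian functional γ_Q vanishes on the two-sided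
ideal of ℂ⟨x₁,…,x_d⟩ generated by the elements xᵢxⱼ − xⱼxᵢ − (Q_{ij} − Q_{ji})·1. -/
theorem gaussian_vanishes_on_commutation_ideal (d : ℕ) (Q : Matrix (Fin d) (Fin d) ℂ)
    (γ : FA d →ₗ[ℂ] ℂ) (hγ : IsGaussian Q γ) (p : FA d)
    (hp : p ∈ TwoSidedIdeal.span
      {q : FA d | ∃ i j : Fin d,
        q = FreeAlgebra.ι ℂ i * FreeAlgebra.ι ℂ j - FreeAlgebra.ι ℂ j * FreeAlgebra.ι ℂ i
            - algebraMap ℂ (FA d) (Q i j - Q j i)}) :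
    γ p = 0 := by
  have hmon (l : List (Fin d)) :
      γ (l.map (FreeAlgebra.ι ℂ)).prod = pairMoment Q l.get := by
    rw [← word_get, hγ.2, gaussMoment_eq_pairMoment]
  have hgen (i j : Fin d) (a b : FA d) :
      γ (a * (FreeAlgebra.ι ℂ i * FreeAlgebra.ι ℂ j - FreeAlgebra.ι ℂ j * FreeAlgebra.ι ℂ i
        - algebraMap ℂ (FA d) (Q i j - Q j i)) * b) = 0 := by
    induction mem_span_range_prod_map_ι a using Submodule.span_induction with
    | zero => simp
    | add x y _ _ hx hy => rw [add_mul, add_mul, map_add, hx, hy, add_zero]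
    | smul c x _ hx => rw [smul_mul_assoc, smul_mul_assoc, map_smul, hx, smul_zero]
    | mem x hx =>
      obtain ⟨u, rfl⟩ := hx
      induction mem_span_range_prod_map_ι b using Submodule.span_induction with
      | zero => simp
      | add x y _ _ hx hy => rw [mul_add, map_add, hx, hy, add_zero]
      | smul c x _ hx => rw [mul_smul_comm, map_smul, hx, smul_zero]
      | mem y hy =>
        obtain ⟨v, rfl⟩ := hy
        have h := pairMoment_get_append Q u v i j
        rw [← hmon, ← hmon, ← hmon, ← smul_eq_mul, ← map_smul, ← map_sub, ← sub_eq_zero,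
          ← map_sub] at h
        rw [← h]
        congr 1
        simp only [List.map_append, List.map_cons, List.prod_append, List.prod_cons,
          mul_sub, sub_mul, Algebra.algebraMap_eq_smul_one, mul_smul_comm, smul_mul_assoc,
          mul_one, mul_assoc]
  rw [TwoSidedIdeal.mem_span_iff_mem_addSubgroup_closure] at hp
  induction hp using AddSubgroup.closure_induction with
  | zero => simp
  | add x y _ _ hx hy => rw [map_add, hx, hy, add_zero]
  | neg x _ hx => rw [map_neg, hx, neg_zero]
  | mem x hx =>
    obtain ⟨_, ⟨a, -, _, ⟨i, j, rfl⟩, rfl⟩, b, -, rfl⟩ := hx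
    exact hgen i j a b

end
end

section
/- Let d ∈ ℕ and let Q be a complex d×d matrix. Let g_Q be the linear functional on ℂ⟨x₁,…,x_d⟩ which vanishes on 1 and on all monomials x_{i₁}⋯x_{iₙ} of length n ≠ 2 and satisfies g_Q(x_{i₁}x_{i₂}) = Q_{i₁,i₂}. Then for every p ∈ ℂ⟨x₁,…,x_d⟩ the series Σ_{k=0}^∞ g_Q^{⋆k}(p)/k! converges and its sum equals γ_Q(p); that is, γ_Q = exp_⋆ g_Q, the convolution exponential of the cumulant functional g_Q. -/
/-!
γ_Q = exp_⋆ g_Q : the gaussian functional is the convolution exponential of its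
cumulant functional, on the free algebra ℂ⟨x₁,…,x_d⟩.
-/

open scoped TensorProduct

noncomputable section

/-- `g` is the cumulant functional g_Q: it vanishes on 1 and on all monomials of length
n ≠ 2 and satisfies g_Q(x_{i₁}x_{i₂}) = Q_{i₁,i₂}. -/
def IsCumulant {d : ℕ} (Q : Matrix (Fin d) (Fin d) ℂ) (g : FA d →ₗ[ℂ] ℂ) : Prop :=
  g 1 = 0 ∧ (∀ (n : ℕ) (w : Fin n → Fin d), n ≠ 2 → g (word w) = 0) ∧
    ∀ i j : Fin d, g (FreeAlgebra.ι ℂ i * FreeAlgebra.ι ℂ j) = Q i j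
section

variable {d : ℕ}

/-- Induction on noncommutative polynomials by left multiplication with the generators. -/
theorem FA.induction_ι_mul {P : FA d → Prop} (one : P 1)
    (smul : ∀ (c : ℂ) p, P p → P (c • p)) (add : ∀ p q, P p → P q → P (p + q))
    (ι_mul : ∀ i p, P p → P (FreeAlgebra.ι ℂ i * p)) (p : FA d) : P p := by
  have key : ∀ p : FA d, ∀ q, P q → P (p * q) := by
    intro p
    induction p using FreeAlgebra.induction with
    | grade0 r =>
      intro q hq
      rw [← Algebra.smul_def]
      exact smul r q hq
    | grade1 i => exact ι_mul i
    | mul a b ha hb =>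
      intro q hq
      rw [mul_assoc]
      exact ha _ (hb _ hq)
    | add a b ha hb =>
      intro q hq
      rw [add_mul]
      exact add _ _ (ha _ hq) (hb _ hq)
  simpa using key p 1 one

theorem word_zero (w : Fin 0 → Fin d) : word w = 1 := by
  simp [word]

theorem word_succ {n : ℕ} (w : Fin (n + 1) → Fin d) :
    word w = FreeAlgebra.ι ℂ (w 0) * word (fun a => w a.succ) := by
  simp [word, List.ofFn_succ]

theorem ι_mul_word {n : ℕ} (i : Fin d) (w : Fin n → Fin d) :
    FreeAlgebra.ι ℂ i * word w = word (Fin.cons i w : Fin (n + 1) → Fin d) := by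
  simp [word_succ]

/-- The monomials span the free algebra. -/
theorem mem_span_word (p : FA d) :
    p ∈ Submodule.span ℂ {q : FA d | ∃ (n : ℕ) (w : Fin n → Fin d), word w = q} := by
  induction p using FA.induction_ι_mul with
  | one => exact Submodule.subset_span ⟨0, Fin.elim0, word_zero _⟩
  | smul c p hp => exact Submodule.smul_mem _ c hp
  | add p q hp hq => exact Submodule.add_mem _ hp hq
  | ι_mul i p hp =>
    induction hp using Submodule.span_induction with
    | mem q hq =>
      obtain ⟨n, w, rfl⟩ := hq
      exact Submodule.subset_span ⟨n + 1, _, (ι_mul_word i w).symm⟩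
    | zero => simp
    | add p q _ _ hp hq =>
      rw [mul_add]
      exact Submodule.add_mem _ hp hq
    | smul c p _ hp =>
      rw [mul_smul_comm]
      exact Submodule.smul_mem _ c hp

/-- Linear functionals that agree on all monomials are equal. -/
theorem FA.hom_ext_word {φ ψ : FA d →ₗ[ℂ] ℂ}
    (h : ∀ (n : ℕ) (w : Fin n → Fin d), φ (word w) = ψ (word w)) : φ = ψ := by
  ext p
  induction mem_span_word p using Submodule.span_induction with
  | mem q hq =>
    obtain ⟨n, w, rfl⟩ := hq
    exact h n w
  | zero => simp
  | add p q _ _ hp hq => simp [hp, hq]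
  | smul c p _ hp => simp [hp]

/-- The functional `p ↦ φ (xᵢ p)`. -/
def shift (i : Fin d) (φ : FA d →ₗ[ℂ] ℂ) : FA d →ₗ[ℂ] ℂ :=
  φ ∘ₗ LinearMap.mulLeft ℂ (FreeAlgebra.ι ℂ i)

theorem shift_apply (i : Fin d) (φ : FA d →ₗ[ℂ] ℂ) (p : FA d) :
    shift i φ p = φ (FreeAlgebra.ι ℂ i * p) := rfl

theorem shift_counit (i : Fin d) : shift i (counitFA d).toLinearMap = 0 := by
  ext p
  simp [shift_apply, counitFA]

theorem conv_apply_one (φ ψ : FA d →ₗ[ℂ] ℂ) : conv d φ ψ 1 = φ 1 * ψ 1 := by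
  simp [conv, Algebra.TensorProduct.one_def]

theorem conv_add_left (φ φ' ψ : FA d →ₗ[ℂ] ℂ) :
    conv d (φ + φ') ψ = conv d φ ψ + conv d φ' ψ := by
  ext p
  simp [conv, TensorProduct.map_add_left]

theorem conv_smul_left (c : ℂ) (φ ψ : FA d →ₗ[ℂ] ℂ) :
    conv d (c • φ) ψ = c • conv d φ ψ := by
  ext p
  simp [conv, TensorProduct.map_smul_left]

theorem conv_add_right (φ ψ ψ' : FA d →ₗ[ℂ] ℂ) :
    conv d φ (ψ + ψ') = conv d φ ψ + conv d φ ψ' := by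
  ext p
  simp [conv, TensorProduct.map_add_right]

theorem conv_smul_right (c : ℂ) (φ ψ : FA d →ₗ[ℂ] ℂ) :
    conv d φ (c • ψ) = c • conv d φ ψ := by
  ext p
  simp [conv, TensorProduct.map_smul_right]

/-- Shifts are derivations of the convolution product. -/
theorem shift_conv (i : Fin d) (φ ψ : FA d →ₗ[ℂ] ℂ) :
    shift i (conv d φ ψ) = conv d (shift i φ) ψ + conv d φ (shift i ψ) := by
  have key : ∀ t : FA d ⊗[ℂ] FA d,
      TensorProduct.lid ℂ ℂ (TensorProduct.map φ ψ
        ((FreeAlgebra.ι ℂ i ⊗ₜ[ℂ] (1 : FA d) + (1 : FA d) ⊗ₜ[ℂ] FreeAlgebra.ι ℂ i) * t)) =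
      TensorProduct.lid ℂ ℂ (TensorProduct.map (shift i φ) ψ t) +
        TensorProduct.lid ℂ ℂ (TensorProduct.map φ (shift i ψ) t) := by
    intro t
    induction t using TensorProduct.induction_on with
    | zero => simp
    | tmul x y => simp [add_mul, shift_apply]
    | add x y hx hy =>
      rw [mul_add, map_add, map_add, hx, hy]
      simp only [map_add]
      ring
  ext p
  simpa [shift_apply, conv, comulFA] using key (comulFA d p)

theorem conv_apply_ι_mul (φ ψ : FA d →ₗ[ℂ] ℂ) (i : Fin d) (p : FA d) :
    conv d φ ψ (FreeAlgebra.ι ℂ i * p) = conv d (shift i φ) ψ p + conv d φ (shift i ψ) p :=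
  LinearMap.congr_fun (shift_conv i φ ψ) p

theorem conv_counit (φ : FA d →ₗ[ℂ] ℂ) : conv d φ (counitFA d).toLinearMap = φ := by
  have h0 : ∀ ψ : FA d →ₗ[ℂ] ℂ, conv d ψ 0 = 0 := fun ψ => by
    simpa using conv_smul_right 0 ψ 0
  ext p
  induction p using FA.induction_ι_mul generalizing φ with
  | one => simp [conv_apply_one]
  | smul c p hp => simp [hp]
  | add p q hp hq => simp [hp, hq]
  | ι_mul i p hp => rw [conv_apply_ι_mul, shift_counit, h0, hp]; simp [shift_apply]

theorem conv_right_comm (φ ψ χ : FA d →ₗ[ℂ] ℂ) :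
    conv d (conv d φ ψ) χ = conv d (conv d φ χ) ψ := by
  ext p
  induction p using FA.induction_ι_mul generalizing φ ψ χ with
  | one => simp only [conv_apply_one]; ring
  | smul c p hp => simp [hp]
  | add p q hp hq => simp [hp, hq]
  | ι_mul i p hp =>
    simp only [conv_apply_ι_mul, shift_conv, conv_add_left, LinearMap.add_apply]
    rw [hp (shift i φ), hp φ (shift i ψ), hp φ ψ]
    ring

theorem shift_convPow_succ (i : Fin d) (g : FA d →ₗ[ℂ] ℂ) (k : ℕ) :
    shift i (convPow d g (k + 1)) = ((k : ℂ) + 1) • conv d (convPow d g k) (shift i g) := by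
  induction k with
  | zero =>
    have h0 : conv d (0 : FA d →ₗ[ℂ] ℂ) g = 0 := by
      simpa using conv_smul_left 0 0 g
    simp only [convPow, shift_conv, shift_counit, h0]
    simp
  | succ k ih =>
    rw [convPow, shift_conv, ih, conv_smul_left, conv_right_comm, ← convPow]
    push_cast
    module

theorem shift_shift_cumulant {Q : Matrix (Fin d) (Fin d) ℂ} {g : FA d →ₗ[ℂ] ℂ}
    (hg : IsCumulant Q g) (i j : Fin d) :
    shift j (shift i g) = Q i j • (counitFA d).toLinearMap := by
  refine FA.hom_ext_word fun n w => ?_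
  cases n with
  | zero => simp [shift_apply, word_zero, hg.2.2]
  | succ n =>
    have h : counitFA d (word w) = 0 := by simp [word_succ, counitFA]
    simp only [shift_apply, ι_mul_word, LinearMap.smul_apply, AlgHom.toLinearMap_apply, h]
    rw [hg.2.1 _ _ (by omega), smul_zero]

theorem shift_cumulant_one {Q : Matrix (Fin d) (Fin d) ℂ} {g : FA d →ₗ[ℂ] ℂ}
    (hg : IsCumulant Q g) (i : Fin d) : shift i g 1 = 0 := by
  rw [shift_apply, ← word_zero (Fin.elim0 : Fin 0 → Fin d), ι_mul_word]
  exact hg.2.1 1 _ (by omega)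

/-- Convolution with a shifted cumulant functional removes one letter at a time. -/
theorem conv_shift_cumulant_word {Q : Matrix (Fin d) (Fin d) ℂ} {g : FA d →ₗ[ℂ] ℂ}
    (hg : IsCumulant Q g) (i : Fin d) (φ : FA d →ₗ[ℂ] ℂ) {n : ℕ} (w : Fin (n + 1) → Fin d) :
    conv d φ (shift i g) (word w) =
      ∑ a, Q i (w a) * φ (word fun b => w (a.succAbove b)) := by
  induction n generalizing φ with
  | zero =>
    rw [word_succ, conv_apply_ι_mul, shift_shift_cumulant hg, conv_smul_right, conv_counit,
      word_zero, conv_apply_one]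
    simp [word_zero, shift_cumulant_one hg]
  | succ n ih =>
    rw [word_succ, conv_apply_ι_mul, shift_shift_cumulant hg, conv_smul_right, conv_counit, ih,
      Fin.sum_univ_succ (n := n + 1), add_comm]
    congr 1
    refine Finset.sum_congr rfl fun a _ => ?_
    rw [shift_apply, word_succ fun b => w (a.succ.succAbove b)]
    simp

theorem gaussMoment_zero (Q : Matrix (Fin d) (Fin d) ℂ) (w : Fin 0 → Fin d) :
    gaussMoment Q w = 1 := by
  simp [gaussMoment]

theorem gaussMoment_one (Q : Matrix (Fin d) (Fin d) ℂ) (w : Fin 1 → Fin d) :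
    gaussMoment Q w = 0 := by
  refine Finset.sum_eq_zero fun f hf => ?_
  exact absurd (Subsingleton.elim (f 0) 0) ((Finset.mem_filter.1 hf).2.1 0)

/-- The order embedding of `Fin m` into `Fin (m + 2)` that skips `0` and `a.succ`. -/
def skipPair {m : ℕ} (a : Fin (m + 1)) : Fin m ↪o Fin (m + 2) :=
  (Fin.succAboveOrderEmb a).trans (Fin.succOrderEmb (m + 1))

theorem skipPair_apply {m : ℕ} (a : Fin (m + 1)) (b : Fin m) :
    skipPair a b = (a.succAbove b).succ := rfl

theorem skipPair_cases {m : ℕ} (a : Fin (m + 1)) (x : Fin (m + 2)) :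
    x = 0 ∨ x = a.succ ∨ ∃ b, x = skipPair a b := by
  induction x using Fin.cases with
  | zero => exact Or.inl rfl
  | succ x =>
    rcases Fin.eq_self_or_eq_succAbove a x with rfl | ⟨b, rfl⟩
    · exact Or.inr (Or.inl rfl)
    · exact Or.inr (Or.inr ⟨b, rfl⟩)

theorem skipPair_ne_zero {m : ℕ} (a : Fin (m + 1)) (b : Fin m) : skipPair a b ≠ 0 :=
  Fin.succ_ne_zero _

theorem skipPair_ne_succ {m : ℕ} (a : Fin (m + 1)) (b : Fin m) : skipPair a b ≠ a.succ :=
  fun h => Fin.succAbove_ne a b (Fin.succ_injective _ h)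

/-- Extends a permutation of `Fin m` to `Fin (m + 2)` by exchanging `0` and `a.succ`. -/
def addPair {m : ℕ} (a : Fin (m + 1)) (f : Equiv.Perm (Fin m)) : Equiv.Perm (Fin (m + 2)) :=
  Equiv.swap 0 a.succ * f.viaEmbedding (skipPair a).toEmbedding

theorem addPair_zero {m : ℕ} (a : Fin (m + 1)) (f : Equiv.Perm (Fin m)) :
    addPair a f 0 = a.succ := by
  rw [addPair, Equiv.Perm.mul_apply, Equiv.Perm.viaEmbedding_apply_of_notMem]
  · simp
  · rintro ⟨b, hb⟩
    exact skipPair_ne_zero a b hb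

theorem addPair_succ {m : ℕ} (a : Fin (m + 1)) (f : Equiv.Perm (Fin m)) :
    addPair a f a.succ = 0 := by
  rw [addPair, Equiv.Perm.mul_apply, Equiv.Perm.viaEmbedding_apply_of_notMem]
  · simp
  · rintro ⟨b, hb⟩
    exact skipPair_ne_succ a b hb

theorem addPair_skipPair {m : ℕ} (a : Fin (m + 1)) (f : Equiv.Perm (Fin m)) (b : Fin m) :
    addPair a f (skipPair a b) = skipPair a (f b) := by
  rw [addPair, Equiv.Perm.mul_apply]
  have h := Equiv.Perm.viaEmbedding_apply f (skipPair a).toEmbedding b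
  simp only [RelEmbedding.coe_toEmbedding] at h
  rw [h, Equiv.swap_apply_of_ne_of_ne (skipPair_ne_zero _ _) (skipPair_ne_succ _ _)]

/-- Fixed-point-free involutions are closed under adding a pair. -/
theorem addPair_isPairing {m : ℕ} (a : Fin (m + 1)) {f : Equiv.Perm (Fin m)}
    (hf : (∀ b, f b ≠ b) ∧ ∀ b, f (f b) = b) :
    (∀ x, addPair a f x ≠ x) ∧ ∀ x, addPair a f (addPair a f x) = x := by
  refine ⟨fun x => ?_, fun x => ?_⟩ <;>
    rcases skipPair_cases a x with rfl | rfl | ⟨b, rfl⟩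
  · rw [addPair_zero]; exact Fin.succ_ne_zero _
  · rw [addPair_succ]; exact (Fin.succ_ne_zero _).symm
  · rw [addPair_skipPair]; exact fun h => hf.1 b ((skipPair a).injective h)
  · rw [addPair_zero, addPair_succ]
  · rw [addPair_succ, addPair_zero]
  · rw [addPair_skipPair, addPair_skipPair, hf.2]

/-- Every fixed-point-free involution of `Fin (m + 2)` arises by adding a pair. -/
theorem exists_addPair_eq {m : ℕ} {f : Equiv.Perm (Fin (m + 2))}
    (hf : (∀ x, f x ≠ x) ∧ ∀ x, f (f x) = x) :
    ∃ (a : Fin (m + 1)) (f' : Equiv.Perm (Fin m)),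
      ((∀ b, f' b ≠ b) ∧ ∀ b, f' (f' b) = b) ∧ addPair a f' = f := by
  obtain ⟨a, ha⟩ := Fin.exists_succ_eq.2 (hf.1 0)
  have hsucc : f a.succ = 0 := by rw [ha, hf.2]
  have hex : ∀ b, ∃ b', f (skipPair a b) = skipPair a b' := by
    intro b
    rcases skipPair_cases a (f (skipPair a b)) with h | h | h
    · rw [← hsucc] at h
      exact absurd (f.injective h) (skipPair_ne_succ a b)
    · rw [ha] at h
      exact absurd (f.injective h) (skipPair_ne_zero a b)
    · exact h
  choose F hF using hex
  have hinv : Function.Involutive F := fun b => (skipPair a).injective <| by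
    rw [← hF, ← hF, hf.2]
  refine ⟨a, hinv.toPerm F, ⟨fun b hb => hf.1 (skipPair a b) ?_, hinv⟩, ?_⟩
  · rw [hF]
    exact congrArg _ hb
  · ext1 x
    rcases skipPair_cases a x with rfl | rfl | ⟨b, rfl⟩
    · rw [addPair_zero, ha]
    · rw [addPair_succ, hsucc]
    · rw [addPair_skipPair, hF]
      rfl

theorem prod_addPair {M : Type*} [CommMonoid M] {m : ℕ} (a : Fin (m + 1))
    (f : Equiv.Perm (Fin m)) (F : Fin (m + 2) → Fin (m + 2) → M) :
    ∏ x with x < addPair a f x, F x (addPair a f x) =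
      F 0 a.succ * ∏ b with b < f b, F (skipPair a b) (skipPair a (f b)) := by
  rw [Finset.prod_filter, Finset.prod_filter, Fin.prod_univ_succ, Fin.prod_univ_succAbove _ a]
  simp_rw [← skipPair_apply, addPair_skipPair, addPair_zero, addPair_succ]
  simp

/-- Wick recursion: sum over the partner of the first letter. -/
theorem gaussMoment_succ_succ (Q : Matrix (Fin d) (Fin d) ℂ) {m : ℕ} (w : Fin (m + 2) → Fin d) :
    gaussMoment Q w =
      ∑ a : Fin (m + 1), Q (w 0) (w a.succ) *
        gaussMoment Q (fun b => w (a.succAbove b).succ) := by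
  simp_rw [gaussMoment, Finset.mul_sum]
  rw [← Finset.sum_product']
  symm
  refine Finset.sum_bij (fun y _ => addPair y.1 y.2) ?_ ?_ ?_ ?_
  · rintro ⟨a, f⟩ h
    simp only [Finset.mem_product, Finset.mem_filter, Finset.mem_univ, true_and] at h ⊢
    exact addPair_isPairing a h
  · rintro ⟨a, f⟩ - ⟨a', f'⟩ - h
    dsimp only at h
    obtain rfl : a = a' := Fin.succ_injective _ <| by
      rw [← addPair_zero a f, h, addPair_zero]
    obtain rfl : f = f' := Equiv.ext fun b => (skipPair a).injective <| by
      rw [← addPair_skipPair, h, addPair_skipPair]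
    rfl
  · intro f hf
    obtain ⟨a, f', hf', rfl⟩ := exists_addPair_eq (Finset.mem_filter.1 hf).2
    exact ⟨(a, f'), by simpa using hf', rfl⟩
  · rintro ⟨a, f⟩ -
    exact (prod_addPair a f fun x y => Q (w x) (w y)).symm

theorem gaussMoment_of_odd (Q : Matrix (Fin d) (Fin d) ℂ) (k : ℕ) {n : ℕ} (hn : n = 2 * k + 1)
    (w : Fin n → Fin d) : gaussMoment Q w = 0 := by
  induction k generalizing n with
  | zero => subst hn; exact gaussMoment_one Q w
  | succ k ih =>
    obtain rfl : n = 2 * k + 1 + 2 := by omega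
    rw [gaussMoment_succ_succ]
    exact Finset.sum_eq_zero fun a _ => by rw [ih rfl, mul_zero]

/-- The `k`-th term of the convolution exponential is the gaussian moment in degree `2 * k`
and vanishes on monomials of any other degree. -/
theorem convPow_cumulant_word {Q : Matrix (Fin d) (Fin d) ℂ} {g : FA d →ₗ[ℂ] ℂ}
    (hg : IsCumulant Q g) (k : ℕ) {n : ℕ} (w : Fin n → Fin d) :
    (k.factorial : ℂ)⁻¹ * convPow d g k (word w) = if n = 2 * k then gaussMoment Q w else 0 := by
  induction k generalizing n with
  | zero =>
    cases n with
    | zero => simp [word_zero, convPow, gaussMoment_zero]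
    | succ n => simp [word_succ, convPow, counitFA]
  | succ k ih =>
    rcases n with _ | _ | m
    · simp [word_zero, convPow, conv_apply_one, hg.1]
    all_goals
      have hk : ((k : ℂ) + 1) ≠ 0 := by exact_mod_cast k.succ_ne_zero
      rw [word_succ, ← shift_apply, shift_convPow_succ, Nat.factorial_succ]
      simp only [LinearMap.smul_apply, smul_eq_mul]
      push_cast
      rw [mul_inv_rev, mul_assoc, inv_mul_cancel_left₀ hk]
    · rw [word_zero, conv_apply_one, shift_cumulant_one hg, if_neg (by omega)]
      simp
    · rw [conv_shift_cumulant_word hg, Finset.mul_sum, gaussMoment_succ_succ]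
      simp_rw [mul_left_comm _ (Q _ _), ih]
      by_cases h : m = 2 * k <;> simp [h, mul_add]

end

/-- For every p ∈ ℂ⟨x₁,…,x_d⟩ the series Σ_{k=0}^∞ g_Q^{⋆k}(p)/k! converges with sum
γ_Q(p); that is, γ_Q = exp_⋆ g_Q. -/
theorem gaussian_eq_convExp_cumulant (d : ℕ) (Q : Matrix (Fin d) (Fin d) ℂ)
    (γ : FA d →ₗ[ℂ] ℂ) (hγ : IsGaussian Q γ)
    (g : FA d →ₗ[ℂ] ℂ) (hg : IsCumulant Q g)
    (p : FA d) :
    HasSum (fun k : ℕ => ((k.factorial : ℂ))⁻¹ * convPow d g k p) (γ p) := by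
  induction mem_span_word p using Submodule.span_induction with
  | mem q hq =>
    obtain ⟨n, w, rfl⟩ := hq
    simp_rw [convPow_cumulant_word hg, hγ.2]
    rcases Nat.even_or_odd' n with ⟨k, hk | hk⟩
    · have h := hasSum_ite_eq k (gaussMoment Q w)
      have hiff : ∀ j, n = 2 * j ↔ j = k := by omega
      simpa only [hiff] using h
    · rw [gaussMoment_of_odd Q k hk]
      simp
  | zero => simp
  | add p q _ _ hp hq => simpa [mul_add] using hp.add hq
  | smul c p _ hp => simpa [mul_left_comm] using hp.mul_left c

end
end

section
/- Let d ∈ ℕ and let Q be a positive semi-definite hermitian complex d×d matrix. Then the cumulant functional g_Q on ℂ⟨x₁,…,x_d⟩ is hermitian (g_Q(p*) equals the complex conjugate of g_Q(p) for all p) and conditionally positive, i.e. g_Q(p* p) ≥ 0 for every polynomial p with δ(p) = 0, where δ is the counit. -/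
/-!
For a positive semi-definite hermitian matrix Q, the cumulant functional g_Q on
ℂ⟨x₁,…,x_d⟩ is hermitian and conditionally positive.
-/

open scoped ComplexOrder

noncomputable section

/-- `st` is the involution p ↦ p* of the *-algebra ℂ⟨x₁,…,x_d⟩: the conjugate-linear
anti-multiplicative map determined by (xᵢ)* = xᵢ (so that (x_{i₁}⋯x_{iₙ})* =
x_{iₙ}⋯x_{i₁} with conjugation of coefficients). -/
structure IsFreeStar (d : ℕ) (st : FA d → FA d) : Prop where
  map_add : ∀ a b : FA d, st (a + b) = st a + st b
  map_smul : ∀ (c : ℂ) (a : FA d), st (c • a) = (starRingEnd ℂ) c • st a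
  map_mul : ∀ a b : FA d, st (a * b) = st b * st a
  map_one : st 1 = 1
  map_gen : ∀ i : Fin d, st (FreeAlgebra.ι ℂ i) = FreeAlgebra.ι ℂ i

/-- The monomial in the free algebra spelled by a list of letters. -/
def listWord {d : ℕ} (l : List (Fin d)) : FA d := (l.map (FreeAlgebra.ι ℂ)).prod

theorem listWord_append {d : ℕ} (l m : List (Fin d)) :
    listWord (l ++ m) = listWord l * listWord m := by
  simp [listWord]

theorem listWord_eq_word {d : ℕ} (l : List (Fin d)) : listWord l = word l.get := by
  unfold listWord word
  conv_lhs => rw [← List.ofFn_get l, List.map_ofFn]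
  rfl

theorem span_range_listWord (d : ℕ) :
    Submodule.span ℂ (Set.range (listWord (d := d))) = ⊤ := by
  rw [eq_top_iff, ← Algebra.top_toSubmodule, ← FreeAlgebra.adjoin_range_ι,
    Algebra.adjoin_eq_span]
  refine Submodule.span_mono fun x hx => ?_
  obtain ⟨l, hl, rfl⟩ := Submonoid.exists_list_of_mem_closure hx
  obtain ⟨m, rfl⟩ : l ∈ Set.range (List.map (FreeAlgebra.ι ℂ (X := Fin d))) := by
    rw [Set.range_list_map]
    exact hl
  exact ⟨m, rfl⟩

theorem induction_listWord {d : ℕ} {P : FA d → Prop}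
    (word : ∀ l : List (Fin d), P (listWord l))
    (add : ∀ a b, P a → P b → P (a + b)) (smul : ∀ (c : ℂ) a, P a → P (c • a))
    (p : FA d) : P p := by
  have hp : p ∈ Submodule.span ℂ (Set.range (listWord (d := d))) := by
    rw [span_range_listWord]; trivial
  induction hp using Submodule.span_induction with
  | mem x hx => obtain ⟨l, rfl⟩ := hx; exact word l
  | zero => simpa using smul 0 _ (word [])
  | add a b _ _ ha hb => exact add a b ha hb
  | smul c a _ ha => exact smul c a ha

theorem IsFreeStar.map_listWord {d : ℕ} {st : FA d → FA d} (hst : IsFreeStar d st)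
    (l : List (Fin d)) : st (listWord l) = listWord l.reverse := by
  induction l with
  | nil => simpa [listWord] using hst.map_one
  | cons i l ih =>
    rw [List.reverse_cons, listWord_append, ← ih]
    simp [listWord, hst.map_mul, hst.map_gen]

theorem IsFreeStar.map_zero {d : ℕ} {st : FA d → FA d} (hst : IsFreeStar d st) :
    st 0 = 0 := by
  simpa using hst.map_smul 0 0

theorem IsFreeStar.map_sum {d : ℕ} {st : FA d → FA d} (hst : IsFreeStar d st)
    {ι : Type*} (s : Finset ι) (f : ι → FA d) : st (∑ i ∈ s, f i) = ∑ i ∈ s, st (f i) :=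
  _root_.map_sum (AddMonoidHom.mk' st hst.map_add) f s

theorem IsCumulant.map_listWord {d : ℕ} {Q : Matrix (Fin d) (Fin d) ℂ} {g : FA d →ₗ[ℂ] ℂ}
    (hg : IsCumulant Q g) (l : List (Fin d)) (hl : l.length ≠ 2) : g (listWord l) = 0 := by
  rw [listWord_eq_word]
  exact hg.2.1 _ _ hl

theorem IsCumulant.hermitian {d : ℕ} {Q : Matrix (Fin d) (Fin d) ℂ} {g : FA d →ₗ[ℂ] ℂ}
    (hg : IsCumulant Q g) {st : FA d → FA d} (hst : IsFreeStar d st)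
    (hQ : ∀ i j : Fin d, Q j i = (starRingEnd ℂ) (Q i j)) (p : FA d) :
    g (st p) = (starRingEnd ℂ) (g p) := by
  induction p using induction_listWord with
  | word l =>
    rw [hst.map_listWord]
    by_cases hl : l.length = 2
    · obtain ⟨i, j, rfl⟩ := List.length_eq_two.mp hl
      simp [listWord, hg.2.2, hQ i j]
    · rw [hg.map_listWord l hl, hg.map_listWord _ (by simpa using hl), _root_.map_zero]
  | add a b ha hb => simp [hst.map_add, ha, hb]
  | smul c a ha => simp [hst.map_smul, ha]

/-- The polynomials all of whose monomials have length at least `n`. -/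
def orderGE (d n : ℕ) : Submodule ℂ (FA d) :=
  Submodule.span ℂ (listWord '' {l | n ≤ l.length})

theorem listWord_mem_orderGE {d n : ℕ} {l : List (Fin d)} (hl : n ≤ l.length) :
    listWord l ∈ orderGE d n :=
  Submodule.subset_span ⟨l, hl, rfl⟩

theorem IsCumulant.map_star_mul_eq_zero {d : ℕ} {Q : Matrix (Fin d) (Fin d) ℂ}
    {g : FA d →ₗ[ℂ] ℂ} (hg : IsCumulant Q g) {st : FA d → FA d} (hst : IsFreeStar d st)
    {m n : ℕ} (hmn : 3 ≤ m + n) {a b : FA d} (ha : a ∈ orderGE d m)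
    (hb : b ∈ orderGE d n) : g (st a * b) = 0 := by
  induction ha using Submodule.span_induction with
  | mem x hx =>
    obtain ⟨k, hk, rfl⟩ := hx
    induction hb using Submodule.span_induction with
    | mem y hy =>
      obtain ⟨l, hl, rfl⟩ := hy
      rw [hst.map_listWord, ← listWord_append]
      refine hg.map_listWord _ ?_
      simp only [Set.mem_ofPred_eq] at hk hl
      simp only [List.length_append, List.length_reverse]
      omega
    | zero => simp
    | add x y _ _ hx hy => simp [mul_add, hx, hy]
    | smul c x _ hx => simp [hx]
  | zero => simp [hst.map_zero]
  | add x y _ _ hx hy => simp [hst.map_add, add_mul, hx, hy]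
  | smul c x _ hx => simp [hst.map_smul, hx]

theorem exists_eq_counit_add_linear_add {d : ℕ} (p : FA d) :
    ∃ v : Fin d → ℂ, ∃ r ∈ orderGE d 2,
      p = counitFA d p • 1 + ∑ i, v i • FreeAlgebra.ι ℂ i + r := by
  induction p using induction_listWord with
  | word l =>
    match l with
    | [] => exact ⟨0, 0, zero_mem _, by simp [listWord]⟩
    | [i] =>
      refine ⟨Pi.single i 1, 0, zero_mem _, ?_⟩
      simp [listWord, counitFA, Pi.single_apply, ite_smul]
    | i :: j :: l =>
      refine ⟨0, listWord (i :: j :: l), listWord_mem_orderGE (by simp), ?_⟩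
      simp [listWord, counitFA]
  | add a b ha hb =>
    obtain ⟨v, r, hr, hv⟩ := ha
    obtain ⟨w, s, hs, hw⟩ := hb
    refine ⟨v + w, r + s, add_mem hr hs, ?_⟩
    conv_lhs => rw [hv, hw]
    simp only [map_add, Pi.add_apply, add_smul, Finset.sum_add_distrib]
    abel
  | smul c a ha =>
    obtain ⟨v, r, hr, hv⟩ := ha
    refine ⟨c • v, c • r, Submodule.smul_mem _ _ hr, ?_⟩
    conv_lhs => rw [hv]
    simp [smul_add, Finset.smul_sum, smul_smul]

theorem IsCumulant.conditionallyPositive {d : ℕ} {Q : Matrix (Fin d) (Fin d) ℂ}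
    {g : FA d →ₗ[ℂ] ℂ} (hg : IsCumulant Q g) {st : FA d → FA d} (hst : IsFreeStar d st)
    (hQ : ∀ v : Fin d → ℂ, 0 ≤ ∑ i, ∑ j, (starRingEnd ℂ) (v i) * Q i j * v j)
    {p : FA d} (hp : counitFA d p = 0) : 0 ≤ g (st p * p) := by
  obtain ⟨v, r, hr, hv⟩ := exists_eq_counit_add_linear_add p
  rw [hp, zero_smul, zero_add] at hv
  have hlin : ∑ i, v i • FreeAlgebra.ι ℂ i ∈ orderGE d 1 :=
    Submodule.sum_mem _ fun i _ => Submodule.smul_mem _ _ <| by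
      simpa [listWord] using listWord_mem_orderGE (n := 1) (l := [i]) (by simp)
  rw [hv, hst.map_add, add_mul, mul_add, mul_add, map_add, map_add, map_add,
    hg.map_star_mul_eq_zero hst (by norm_num) hlin hr,
    hg.map_star_mul_eq_zero hst (by norm_num) hr hlin,
    hg.map_star_mul_eq_zero hst (by norm_num) hr hr, add_zero, add_zero, add_zero]
  convert hQ v using 1
  simp only [hst.map_sum, hst.map_smul, hst.map_gen, Finset.sum_mul, Finset.mul_sum, map_sum,
    smul_mul_assoc, mul_smul_comm, map_smul, hg.2.2, smul_eq_mul]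
  rw [Finset.sum_comm]
  refine Finset.sum_congr rfl fun i _ => Finset.sum_congr rfl fun j _ => ?_
  ring

/-- Let Q be a positive semi-definite hermitian complex d×d matrix.  Then the cumulant
functional g_Q is hermitian (g_Q(p*) = conj (g_Q(p))) and conditionally positive
(g_Q(p* p) ≥ 0 whenever δ(p) = 0, with δ the counit). -/
theorem cumulant_hermitian_conditionallyPositive (d : ℕ) (Q : Matrix (Fin d) (Fin d) ℂ)
    (hQherm : ∀ i j : Fin d, Q j i = (starRingEnd ℂ) (Q i j))
    (hQpos : ∀ v : Fin d → ℂ, 0 ≤ ∑ i, ∑ j, (starRingEnd ℂ) (v i) * Q i j * v j)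
    (st : FA d → FA d) (hst : IsFreeStar d st)
    (g : FA d →ₗ[ℂ] ℂ) (hg : IsCumulant Q g) :
    (∀ p : FA d, g (st p) = (starRingEnd ℂ) (g p)) ∧
    (∀ p : FA d, counitFA d p = 0 → 0 ≤ g (st p * p)) :=
  ⟨hg.hermitian hst hQherm, fun _ hp => hg.conditionallyPositive hst hQpos hp⟩

end
end

section
/- Let (Vᵢ)_{i∈I} be a family of linear subspaces of a complex vector space V and (Wᵢ)_{i∈I} a family of linear subspaces of a complex vector space W, indexed by the same index set I. Then, inside V ⊗ W, the intersection ⋂_{i∈I} (Vᵢ ⊗ Wᵢ) equals (⋂_{i∈I} Vᵢ) ⊗ (⋂_{i∈I} Wᵢ). -/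
/-!
Intersections of tensor products of subspaces:
⋂ᵢ (Vᵢ ⊗ Wᵢ) = (⋂ᵢ Vᵢ) ⊗ (⋂ᵢ Wᵢ) inside V ⊗ W.
-/

open scoped TensorProduct

/-- The canonical image of V' ⊗ W' in V ⊗ W, for subspaces V' ⊆ V and W' ⊆ W:
the range of the tensor product of the inclusion maps. -/
noncomputable def subTensor {V W : Type*} [AddCommGroup V] [Module ℂ V]
    [AddCommGroup W] [Module ℂ W] (V' : Submodule ℂ V) (W' : Submodule ℂ W) :
    Submodule ℂ (V ⊗[ℂ] W) :=
  LinearMap.range (TensorProduct.map V'.subtype W'.subtype)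

/-- An element of `V ⊗ W` lies in the image of `V' ⊗ W` iff all of its
coefficients along a basis of `W` lie in `V'`, the given subspace of the first factor. -/
theorem mem_range_rTensor_subtype_iff {V W κ : Type*} [AddCommGroup V] [Module ℂ V]
    [AddCommGroup W] [Module ℂ W] [DecidableEq κ] (b : Module.Basis κ ℂ W) (V' : Submodule ℂ V)
    (x : V ⊗[ℂ] W) :
    x ∈ LinearMap.range (V'.subtype.rTensor W) ↔
      ∀ j, TensorProduct.equivFinsuppOfBasisRight b x j ∈ V' := by
  constructor
  · rintro ⟨y, rfl⟩ j
    induction y with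
    | zero => simp
    | add y z hy hz => simpa using V'.add_mem hy hz
    | tmul v w =>
      simpa using V'.smul_mem _ v.2
  · intro h
    rw [← (TensorProduct.equivFinsuppOfBasisRight b).symm_apply_apply x,
      TensorProduct.equivFinsuppOfBasisRight_symm_apply]
    exact Submodule.sum_mem _ fun j _ => ⟨⟨_, h j⟩ ⊗ₜ b j, rfl⟩

theorem iInf_range_rTensor_subtype {V W I : Type*} [AddCommGroup V] [Module ℂ V]
    [AddCommGroup W] [Module ℂ W] (Vs : I → Submodule ℂ V) :
    ⨅ i, LinearMap.range ((Vs i).subtype.rTensor W) =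
      LinearMap.range ((⨅ i, Vs i).subtype.rTensor W) := by
  classical
  ext x
  simp only [Submodule.mem_iInf,
    mem_range_rTensor_subtype_iff (Module.Basis.ofVectorSpace ℂ W)]
  exact forall_comm

theorem range_lTensor_eq_comap_comm {V W : Type*} [AddCommGroup V] [Module ℂ V]
    [AddCommGroup W] [Module ℂ W] (W' : Submodule ℂ W) :
    LinearMap.range (W'.subtype.lTensor V) =
      (LinearMap.range (W'.subtype.rTensor V)).comap (TensorProduct.comm ℂ V W).toLinearMap := by
  rw [← LinearMap.comm_comp_rTensor_comp_comm_eq, LinearMap.range_comp,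
    LinearEquiv.range_comp]
  exact Submodule.map_equiv_eq_comap_symm (TensorProduct.comm ℂ W V) _

theorem iInf_range_lTensor_subtype {V W I : Type*} [AddCommGroup V] [Module ℂ V]
    [AddCommGroup W] [Module ℂ W] (Ws : I → Submodule ℂ W) :
    ⨅ i, LinearMap.range ((Ws i).subtype.lTensor V) =
      LinearMap.range ((⨅ i, Ws i).subtype.lTensor V) := by
  simp only [range_lTensor_eq_comap_comm, ← Submodule.comap_iInf, iInf_range_rTensor_subtype]

/-- Inside `V ⊗ W`, the subspace `V' ⊗ W'` is the intersection of `V' ⊗ W` and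
`V ⊗ W'` as subspaces of the whole tensor product. -/
theorem subTensor_eq_inf {V W : Type*} [AddCommGroup V] [Module ℂ V]
    [AddCommGroup W] [Module ℂ W] (V' : Submodule ℂ V) (W' : Submodule ℂ W) :
    subTensor V' W' =
      LinearMap.range (V'.subtype.rTensor W) ⊓ LinearMap.range (W'.subtype.lTensor V) := by
  apply le_antisymm
  · refine le_inf ?_ ?_
    · rw [subTensor, ← LinearMap.rTensor_comp_lTensor]
      exact LinearMap.range_comp_le_range _ _
    · rw [subTensor, ← LinearMap.lTensor_comp_rTensor]
      exact LinearMap.range_comp_le_range _ _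
  · rintro _ ⟨⟨y, rfl⟩, hy⟩
    have hy' : W'.mkQ.lTensor V (V'.subtype.rTensor W y) = 0 :=
      (lTensor_exact V (LinearMap.exact_subtype_mkQ W') W'.mkQ_surjective _).2 hy
    have hinj := Module.Flat.rTensor_preserves_injective_linearMap (M := W ⧸ W')
      V'.subtype V'.injective_subtype
    have hy0 : W'.mkQ.lTensor V' y = 0 := by
      apply hinj
      rw [map_zero, ← hy', ← LinearMap.comp_apply, ← LinearMap.comp_apply,
        LinearMap.rTensor_comp_lTensor, LinearMap.lTensor_comp_rTensor]
    obtain ⟨z, rfl⟩ :=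
      (lTensor_exact V' (LinearMap.exact_subtype_mkQ W') W'.mkQ_surjective _).1 hy0
    rw [subTensor, ← LinearMap.rTensor_comp_lTensor]
    exact ⟨z, rfl⟩

/-- For families (Vᵢ)_{i∈I} of subspaces of V and (Wᵢ)_{i∈I} of subspaces of W,
⋂_{i∈I} (Vᵢ ⊗ Wᵢ) = (⋂_{i∈I} Vᵢ) ⊗ (⋂_{i∈I} Wᵢ) inside V ⊗ W. -/
theorem iInf_subTensor (V W : Type*) [AddCommGroup V] [Module ℂ V]
    [AddCommGroup W] [Module ℂ W] (I : Type*)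
    (Vs : I → Submodule ℂ V) (Ws : I → Submodule ℂ W) :
    (⨅ i : I, subTensor (Vs i) (Ws i)) = subTensor (⨅ i : I, Vs i) (⨅ i : I, Ws i) := by
  simp only [subTensor_eq_inf, iInf_inf_eq, iInf_range_rTensor_subtype,
    iInf_range_lTensor_subtype]
end

section
/- (Fundamental theorem of coalgebras.) Let M be a finite subset of a coalgebra (C, Δ, δ) over ℂ. Then the sub-coalgebra ⟨M⟩ generated by M (the intersection of all sub-coalgebras of C containing M) is finite-dimensional. In particular, every element c ∈ C is contained in a finite-dimensional sub-coalgebra of C. -/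
/-!
Fundamental theorem of coalgebras: the sub-coalgebra generated by a finite set is
finite-dimensional; in particular every element lies in a finite-dimensional
sub-coalgebra.
-/

open scoped TensorProduct

/-- A linear subspace D of a coalgebra C is a sub-coalgebra if Δ(D) is contained in the
canonical image of D ⊗ D in C ⊗ C (the range of the tensor product of the inclusions). -/
def IsSubcoalgebra {C : Type*} [AddCommGroup C] [Module ℂ C] [Coalgebra ℂ C]
    (D : Submodule ℂ C) : Prop :=
  ∀ c ∈ D, Coalgebra.comul (R := ℂ) c ∈
    LinearMap.range (TensorProduct.map D.subtype D.subtype)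

/-- The sub-coalgebra ⟨M⟩ generated by a subset M of a coalgebra C: the intersection of
all sub-coalgebras of C containing M. -/
noncomputable def generatedSubcoalgebra {C : Type*} [AddCommGroup C] [Module ℂ C]
    [Coalgebra ℂ C] (M : Set C) : Submodule ℂ C :=
  sInf {D : Submodule ℂ C | IsSubcoalgebra D ∧ M ⊆ (D : Set C)}

namespace CoalgebraSlice

open Coalgebra

variable {K C : Type*} [Field K] [AddCommGroup C] [Module K C]

/-- Contraction of the right tensor factor against a functional. -/
noncomputable def sliceRight : Module.Dual K C →ₗ[K] C ⊗[K] C →ₗ[K] C :=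
  (LinearMap.llcomp K (C ⊗[K] C) (C ⊗[K] K) C (TensorProduct.rid K C).toLinearMap) ∘ₗ
    LinearMap.lTensorHom C

/-- Contraction of the left tensor factor against a functional. -/
noncomputable def sliceLeft : Module.Dual K C →ₗ[K] C ⊗[K] C →ₗ[K] C :=
  (LinearMap.llcomp K (C ⊗[K] C) (K ⊗[K] C) C (TensorProduct.lid K C).toLinearMap) ∘ₗ
    LinearMap.rTensorHom C

@[simp]
theorem sliceRight_tmul (h : Module.Dual K C) (a b : C) :
    sliceRight h (a ⊗ₜ[K] b) = h b • a := by
  simp [sliceRight]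

@[simp]
theorem sliceLeft_tmul (h : Module.Dual K C) (a b : C) :
    sliceLeft h (a ⊗ₜ[K] b) = h a • b := by
  simp [sliceLeft]

theorem eq_zero_of_sliceRight {t : C ⊗[K] C} (ht : ∀ h, sliceRight h t = 0) : t = 0 := by
  classical
  let b := Module.Basis.ofVectorSpace K C
  apply (TensorProduct.equivFinsuppOfBasisRight (M := C) b).injective
  rw [map_zero]
  ext i
  rw [Finsupp.zero_apply, ← ht (b.coord i)]
  clear ht
  induction t with
  | zero => simp
  | tmul x y => simp
  | add x y hx hy => simp [hx, hy]

theorem sliceRight_comm (h : Module.Dual K C) (t : C ⊗[K] C) :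
    sliceRight h (TensorProduct.comm K C C t) = sliceLeft h t := by
  induction t with
  | zero => simp
  | tmul x y => simp
  | add x y hx hy => simp [hx, hy]

theorem eq_zero_of_sliceLeft {t : C ⊗[K] C} (ht : ∀ h, sliceLeft h t = 0) : t = 0 := by
  apply (TensorProduct.comm K C C).injective
  rw [map_zero]
  exact eq_zero_of_sliceRight fun h => by rw [sliceRight_comm, ht]

theorem sliceRight_rTensor (h : Module.Dual K C) (f : C →ₗ[K] C) (t : C ⊗[K] C) :
    sliceRight h (f.rTensor C t) = f (sliceRight h t) := by
  induction t with
  | zero => simp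
  | tmul x y => simp
  | add x y hx hy => simp [hx, hy]

theorem sliceLeft_lTensor (h : Module.Dual K C) (f : C →ₗ[K] C) (t : C ⊗[K] C) :
    sliceLeft h (f.lTensor C t) = f (sliceLeft h t) := by
  induction t with
  | zero => simp
  | tmul x y => simp
  | add x y hx hy => simp [hx, hy]

/-- A tensor all of whose left and right slices lie in `D` comes from `D ⊗ D`. -/
theorem mem_range_map_subtype {D : Submodule K C} {t : C ⊗[K] C}
    (hr : ∀ h, sliceRight h t ∈ D) (hl : ∀ h, sliceLeft h t ∈ D) :
    t ∈ LinearMap.range (TensorProduct.map D.subtype D.subtype) := by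
  obtain ⟨p, hp⟩ := D.subtype.exists_leftInverse_of_injective D.ker_subtype
  have hpD : ∀ x ∈ D, D.subtype (p x) = x := fun x hx =>
    congrArg Subtype.val (LinearMap.congr_fun hp ⟨x, hx⟩)
  have h₁ : (D.subtype ∘ₗ p).rTensor C t = t := by
    refine sub_eq_zero.mp (eq_zero_of_sliceRight fun h => ?_)
    rw [map_sub, sliceRight_rTensor, LinearMap.comp_apply, hpD _ (hr h), sub_self]
  have h₂ : (D.subtype ∘ₗ p).lTensor C t = t := by
    refine sub_eq_zero.mp (eq_zero_of_sliceLeft fun h => ?_)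
    rw [map_sub, sliceLeft_lTensor, LinearMap.comp_apply, hpD _ (hl h), sub_self]
  refine ⟨TensorProduct.map p p t, ?_⟩
  rw [← LinearMap.comp_apply, ← TensorProduct.map_comp, ← LinearMap.rTensor_comp_lTensor,
    LinearMap.comp_apply, h₂, h₁]

theorem fg_range_flip_sliceRight (t : C ⊗[K] C) :
    (LinearMap.range ((sliceRight (K := K)).flip t)).FG := by
  induction t with
  | zero => simpa using Submodule.fg_bot
  | tmul x y =>
    refine (Submodule.fg_span_singleton (R := K) x).of_le ?_
    rintro _ ⟨h, rfl⟩
    simpa using Submodule.smul_mem _ _ (Submodule.mem_span_singleton_self x)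
  | add x y hx hy =>
    refine (hx.sup hy).of_le ?_
    rw [map_add]
    exact LinearMap.range_add_le _ _

theorem fg_range_flip_sliceLeft (t : C ⊗[K] C) :
    (LinearMap.range ((sliceLeft (K := K)).flip t)).FG := by
  convert fg_range_flip_sliceRight (TensorProduct.comm K C C t) using 2
  ext h
  exact (sliceRight_comm h t).symm

variable [Coalgebra K C]

/-- The action `h ↦ (c ↦ c₍₁₎ h(c₍₂₎))` of the dual of a coalgebra. -/
noncomputable def actRight : Module.Dual K C →ₗ[K] C →ₗ[K] C :=
  (sliceRight (K := K)).compl₂ comul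

/-- The action `h ↦ (c ↦ h(c₍₁₎) c₍₂₎)` of the dual of a coalgebra. -/
noncomputable def actLeft : Module.Dual K C →ₗ[K] C →ₗ[K] C :=
  (sliceLeft (K := K)).compl₂ comul

theorem actRight_apply (h : Module.Dual K C) (c : C) :
    actRight h c = sliceRight h (comul c) := rfl

theorem actLeft_apply (h : Module.Dual K C) (c : C) :
    actLeft h c = sliceLeft h (comul c) := rfl

theorem actRight_counit (c : C) : actRight (counit (R := K)) c = c := by
  simp [actRight, sliceRight]

theorem actLeft_counit (c : C) : actLeft (counit (R := K)) c = c := by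
  simp [actLeft, sliceLeft]

theorem fg_map₂_actRight {V : Submodule K C} (hV : V.FG) :
    (Submodule.map₂ (actRight (K := K)) ⊤ V).FG := by
  induction V, hV using Submodule.fg_induction with
  | singleton x =>
    rw [Submodule.map₂_span_singleton_eq_map_flip, Submodule.map_top]
    exact fg_range_flip_sliceRight (comul x)
  | sup V W _ _ hV hW =>
    rw [Submodule.map₂_sup_right]
    exact hV.sup hW

theorem fg_map₂_actLeft {V : Submodule K C} (hV : V.FG) :
    (Submodule.map₂ (actLeft (K := K)) ⊤ V).FG := by
  induction V, hV using Submodule.fg_induction with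
  | singleton x =>
    rw [Submodule.map₂_span_singleton_eq_map_flip, Submodule.map_top]
    exact fg_range_flip_sliceLeft (comul x)
  | sup V W _ _ hV hW =>
    rw [Submodule.map₂_sup_right]
    exact hV.sup hW

theorem actRight_actRight (h g : Module.Dual K C) (c : C) :
    actRight h (actRight g c) =
      actRight (LinearMap.mul' K K ∘ₗ TensorProduct.map h g ∘ₗ comul) c := by
  let Φ : C ⊗[K] (C ⊗[K] C) →ₗ[K] C :=
    TensorProduct.rid K C ∘ₗ (LinearMap.mul' K K ∘ₗ TensorProduct.map h g).lTensor C
  have e₁ (t : C ⊗[K] C) : actRight h (sliceRight g t) =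
      Φ (TensorProduct.assoc K C C C (comul.rTensor C t)) := by
    induction t with
    | zero => simp
    | add x y hx hy => simp [hx, hy]
    | tmul a b =>
      simp only [sliceRight_tmul, map_smul, actRight_apply, LinearMap.rTensor_tmul]
      induction comul (R := K) a with
      | zero => simp
      | add x y hx hy => simp [hx, hy, TensorProduct.add_tmul]
      | tmul x y => simp [Φ, smul_smul, mul_comm]
  have e₂ (t : C ⊗[K] C) :
      sliceRight (LinearMap.mul' K K ∘ₗ TensorProduct.map h g ∘ₗ comul) t =
      Φ (comul.lTensor C t) := by
    induction t with
    | zero => simp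
    | add x y hx hy => simp [hx, hy]
    | tmul a b => simp [Φ]
  rw [actRight_apply g, e₁, coassoc_apply, ← e₂, actRight_apply]

theorem actLeft_actLeft (h g : Module.Dual K C) (c : C) :
    actLeft h (actLeft g c) =
      actLeft (LinearMap.mul' K K ∘ₗ TensorProduct.map g h ∘ₗ comul) c := by
  let Φ : (C ⊗[K] C) ⊗[K] C →ₗ[K] C :=
    TensorProduct.lid K C ∘ₗ (LinearMap.mul' K K ∘ₗ TensorProduct.map g h).rTensor C
  have e₁ (t : C ⊗[K] C) : actLeft h (sliceLeft g t) =
      Φ ((TensorProduct.assoc K C C C).symm (comul.lTensor C t)) := by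
    induction t with
    | zero => simp
    | add x y hx hy => simp [hx, hy]
    | tmul a b =>
      simp only [sliceLeft_tmul, map_smul, actLeft_apply, LinearMap.lTensor_tmul]
      induction comul (R := K) b with
      | zero => simp
      | add x y hx hy => simp [hx, hy, TensorProduct.tmul_add]
      | tmul x y => simp [Φ, smul_smul]
  have e₂ (t : C ⊗[K] C) :
      sliceLeft (LinearMap.mul' K K ∘ₗ TensorProduct.map g h ∘ₗ comul) t =
      Φ (comul.rTensor C t) := by
    induction t with
    | zero => simp
    | add x y hx hy => simp [hx, hy]
    | tmul a b => simp [Φ]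
  rw [actLeft_apply g, e₁, coassoc_symm_apply, ← e₂, actLeft_apply]

theorem actRight_actLeft (h g : Module.Dual K C) (c : C) :
    actRight h (actLeft g c) = actLeft g (actRight h c) := by
  let Φ : C ⊗[K] (C ⊗[K] C) →ₗ[K] C :=
    TensorProduct.lid K C ∘ₗ TensorProduct.map g (sliceRight h)
  have e₁ (t : C ⊗[K] C) : actRight h (sliceLeft g t) = Φ (comul.lTensor C t) := by
    induction t with
    | zero => simp
    | add x y hx hy => simp [hx, hy]
    | tmul a b => simp [Φ, actRight_apply]
  have e₂ (t : C ⊗[K] C) : actLeft g (sliceRight h t) =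
      Φ (TensorProduct.assoc K C C C (comul.rTensor C t)) := by
    induction t with
    | zero => simp
    | add x y hx hy => simp [hx, hy]
    | tmul a b =>
      simp only [sliceRight_tmul, map_smul, actLeft_apply, LinearMap.rTensor_tmul]
      induction comul (R := K) a with
      | zero => simp
      | add x y hx hy => simp [hx, hy, TensorProduct.add_tmul]
      | tmul x y => simp [Φ, smul_smul]
  rw [actLeft_apply g c, actRight_apply h c, e₁, e₂, coassoc_apply]

/-- A finitely generated subspace lies in a finitely generated subspace stable under both
actions of the dual. -/
theorem exists_fg_stable {V : Submodule K C} (hV : V.FG) :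
    ∃ D : Submodule K C, D.FG ∧ V ≤ D ∧
      (∀ h : Module.Dual K C, ∀ c ∈ D, actRight h c ∈ D) ∧
      ∀ h : Module.Dual K C, ∀ c ∈ D, actLeft h c ∈ D := by
  let E := Submodule.map₂ (actRight (K := K)) ⊤ V
  have hVE : V ≤ E := fun c hc =>
    actRight_counit (K := K) c ▸ Submodule.apply_mem_map₂ _ Submodule.mem_top hc
  have hE (h : Module.Dual K C) : E ≤ E.comap (actRight h) :=
    Submodule.map₂_le.mpr fun g _ c hc => by
      rw [Submodule.mem_comap, actRight_actRight]
      exact Submodule.apply_mem_map₂ _ Submodule.mem_top hc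
  let D := Submodule.map₂ (actLeft (K := K)) ⊤ E
  have hED : E ≤ D := fun c hc =>
    actLeft_counit (K := K) c ▸ Submodule.apply_mem_map₂ _ Submodule.mem_top hc
  have hDr (h : Module.Dual K C) : D ≤ D.comap (actRight h) :=
    Submodule.map₂_le.mpr fun g _ c hc => by
      rw [Submodule.mem_comap, actRight_actLeft]
      exact Submodule.apply_mem_map₂ _ Submodule.mem_top (hE h hc)
  have hDl (h : Module.Dual K C) : D ≤ D.comap (actLeft h) :=
    Submodule.map₂_le.mpr fun g _ c hc => by
      rw [Submodule.mem_comap, actLeft_actLeft]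
      exact Submodule.apply_mem_map₂ _ Submodule.mem_top hc
  exact ⟨D, fg_map₂_actLeft (fg_map₂_actRight hV), hVE.trans hED,
    fun h _ hc => hDr h hc, fun h _ hc => hDl h hc⟩

end CoalgebraSlice

theorem exists_finiteDimensional_isSubcoalgebra {C : Type*} [AddCommGroup C] [Module ℂ C]
    [Coalgebra ℂ C] (M : Finset C) :
    ∃ D : Submodule ℂ C, IsSubcoalgebra D ∧ FiniteDimensional ℂ D ∧ (M : Set C) ⊆ D := by
  obtain ⟨D, hfg, hMD, hr, hl⟩ :=
    CoalgebraSlice.exists_fg_stable (Submodule.fg_span (R := ℂ) M.finite_toSet)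
  exact ⟨D, fun c hc => CoalgebraSlice.mem_range_map_subtype (fun h => hr h c hc)
    fun h => hl h c hc, Module.Finite.iff_fg.mpr hfg, Submodule.span_le.mp hMD⟩

/-- **Fundamental theorem of coalgebras.**  For a finite subset M of a coalgebra C the
sub-coalgebra ⟨M⟩ generated by M is finite-dimensional.  In particular, every element
c ∈ C is contained in a finite-dimensional sub-coalgebra of C. -/
theorem generatedSubcoalgebra_finiteDimensional
    {C : Type*} [AddCommGroup C] [Module ℂ C] [Coalgebra ℂ C] (M : Finset C) :
    FiniteDimensional ℂ (generatedSubcoalgebra (M : Set C)) ∧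
    ∀ c : C, ∃ D : Submodule ℂ C,
      IsSubcoalgebra D ∧ FiniteDimensional ℂ D ∧ c ∈ D := by
  obtain ⟨D, hD, hfin, hMD⟩ := exists_finiteDimensional_isSubcoalgebra M
  refine ⟨Submodule.finiteDimensional_of_le (sInf_le ⟨hD, hMD⟩), fun c => ?_⟩
  obtain ⟨D, hD, hfin, hcD⟩ := exists_finiteDimensional_isSubcoalgebra {c}
  exact ⟨D, hD, hfin, hcD (by simp)⟩
end

section
/- Every coalgebra (C, Δ, δ) over ℂ is the union (equivalently, the directed sum) of its finite-dimensional sub-coalgebras: for every c ∈ C there is a finite-dimensional sub-coalgebra D of C with c ∈ D, and the system of finite-dimensional sub-coalgebras is directed by inclusion. -/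
/-!
Every coalgebra is the directed union of its finite-dimensional sub-coalgebras.
-/

open scoped TensorProduct

namespace TensorProduct

open Module

variable {K C : Type*} [Field K] [AddCommGroup C] [Module K C]

variable (K C)

/-- The left slice `(f ⊗ id) t` of a tensor `t`. -/
noncomputable def leftSlice : Dual K C →ₗ[K] C ⊗[K] C →ₗ[K] C :=
  (LinearMap.rTensorHom C).compr₂ (TensorProduct.lid K C).toLinearMap

/-- The right slice `(id ⊗ g) t` of a tensor `t`. -/
noncomputable def rightSlice : Dual K C →ₗ[K] C ⊗[K] C →ₗ[K] C :=
  (LinearMap.lTensorHom C).compr₂ (TensorProduct.rid K C).toLinearMap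

variable {K C}

@[simp]
lemma leftSlice_tmul (f : Dual K C) (a b : C) : leftSlice K C f (a ⊗ₜ b) = f a • b := by
  simp [leftSlice]

@[simp]
lemma rightSlice_tmul (g : Dual K C) (a b : C) : rightSlice K C g (a ⊗ₜ b) = g b • a := by
  simp [rightSlice]

lemma leftSlice_comm (f : Dual K C) (t : C ⊗[K] C) :
    leftSlice K C f (TensorProduct.comm K C C t) = rightSlice K C f t := by
  induction t with
  | zero => simp
  | tmul a b => simp
  | add s t hs ht => simp [hs, ht]

lemma ext_leftSlice {s t : C ⊗[K] C} (h : ∀ f, leftSlice K C f s = leftSlice K C f t) :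
    s = t := by
  classical
  let b := Basis.ofVectorSpace K C
  have key (i) (u : C ⊗[K] C) :
      equivFinsuppOfBasisLeft b u i = leftSlice K C (b.coord i) u := by
    induction u with
    | zero => simp
    | tmul x y => simp
    | add u v hu hv => simp [hu, hv]
  refine (equivFinsuppOfBasisLeft b).injective (Finsupp.ext fun i => ?_)
  rw [key, key, h]

lemma ext_rightSlice {s t : C ⊗[K] C} (h : ∀ g, rightSlice K C g s = rightSlice K C g t) :
    s = t :=
  (TensorProduct.comm K C C).injective (ext_leftSlice fun f => by simpa [leftSlice_comm] using h f)

lemma leftSlice_lTensor (f : Dual K C) (p : C →ₗ[K] C) (t : C ⊗[K] C) :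
    leftSlice K C f (p.lTensor C t) = p (leftSlice K C f t) := by
  induction t with
  | zero => simp
  | tmul a b => simp
  | add s t hs ht => simp [hs, ht]

lemma rightSlice_rTensor (g : Dual K C) (p : C →ₗ[K] C) (t : C ⊗[K] C) :
    rightSlice K C g (p.rTensor C t) = p (rightSlice K C g t) := by
  induction t with
  | zero => simp
  | tmul a b => simp
  | add s t hs ht => simp [hs, ht]

lemma leftSlice_assoc (f : Dual K C) (t : (C ⊗[K] C) ⊗[K] C) :
    (TensorProduct.lid K (C ⊗[K] C)) (f.rTensor _ (TensorProduct.assoc K C C C t)) =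
      (leftSlice K C f).rTensor C t := by
  induction t with
  | zero => simp
  | tmul u c =>
    induction u with
    | zero => simp
    | tmul a b => simp [TensorProduct.smul_tmul']
    | add s t hs ht => simp_all [TensorProduct.add_tmul]
  | add s t hs ht => simp_all

lemma finiteDimensional_range_leftSlice (t : C ⊗[K] C) :
    FiniteDimensional K (LinearMap.range ((leftSlice K C).flip t)) := by
  induction t with
  | zero => rw [map_zero, LinearMap.range_zero]; infer_instance
  | tmul a b =>
    refine Submodule.finiteDimensional_of_le (S₂ := K ∙ b) ?_
    rintro _ ⟨f, rfl⟩
    exact Submodule.mem_span_singleton.2 ⟨f a, by simp⟩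
  | add s t hs ht =>
    rw [map_add]
    exact Submodule.finiteDimensional_of_le (LinearMap.range_add_le _ _)

lemma finiteDimensional_range_rightSlice (t : C ⊗[K] C) :
    FiniteDimensional K (LinearMap.range ((rightSlice K C).flip t)) := by
  have : (rightSlice K C).flip t = (leftSlice K C).flip (TensorProduct.comm K C C t) := by
    ext f
    simp [leftSlice_comm]
  rw [this]
  exact finiteDimensional_range_leftSlice _

/-- A tensor all of whose left and right slices lie in `D` belongs to the image of `D ⊗ D`. -/
lemma mem_range_map_subtype_of_slices_mem {D : Submodule K C} {t : C ⊗[K] C}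
    (hl : ∀ f, leftSlice K C f t ∈ D) (hr : ∀ g, rightSlice K C g t ∈ D) :
    t ∈ LinearMap.range (TensorProduct.map D.subtype D.subtype) := by
  obtain ⟨P, hP⟩ := D.subtype.exists_leftInverse_of_injective D.ker_subtype
  let p : C →ₗ[K] C := D.subtype ∘ₗ P
  have hp (x : C) (hx : x ∈ D) : p x = x :=
    congrArg Subtype.val (LinearMap.congr_fun hP ⟨x, hx⟩)
  have h₁ : p.lTensor C t = t := ext_leftSlice fun f => by
    rw [leftSlice_lTensor, hp _ (hl f)]
  have h₂ : p.rTensor C t = t := ext_rightSlice fun g => by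
    rw [rightSlice_rTensor, hp _ (hr g)]
  refine ⟨TensorProduct.map P P t, ?_⟩
  calc TensorProduct.map D.subtype D.subtype (TensorProduct.map P P t)
      = TensorProduct.map p p t := by
        rw [← LinearMap.comp_apply, ← TensorProduct.map_comp]
    _ = p.lTensor C (p.rTensor C t) := by
        rw [← LinearMap.comp_apply, LinearMap.lTensor_comp_rTensor]
    _ = t := by rw [h₂, h₁]

end TensorProduct

namespace Coalgebra

open Module _root_.TensorProduct

variable {K C : Type*} [Field K] [AddCommGroup C] [Module K C] [Coalgebra K C]

variable (K C) in
/-- The action `x ↦ (f ⊗ id) (Δ x)` of the dual on a coalgebra. -/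
noncomputable def leftAct : Dual K C →ₗ[K] C →ₗ[K] C := (leftSlice K C).compl₂ comul

variable (K C) in
/-- The action `x ↦ (id ⊗ g) (Δ x)` of the dual on a coalgebra. -/
noncomputable def rightAct : Dual K C →ₗ[K] C →ₗ[K] C := (rightSlice K C).compl₂ comul

lemma leftAct_apply (f : Dual K C) (x : C) : leftAct K C f x = leftSlice K C f (comul x) := rfl

lemma rightAct_apply (g : Dual K C) (x : C) : rightAct K C g x = rightSlice K C g (comul x) := rfl

@[simp]
lemma leftAct_counit (x : C) : leftAct K C counit x = x := by
  simp [leftAct, leftSlice]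

@[simp]
lemma rightAct_counit (x : C) : rightAct K C counit x = x := by
  simp [rightAct, rightSlice]

/-- `Δ ((f ⊗ id) (Δ x)) = ((f ⊗ id) ∘ Δ ⊗ id) (Δ x)`. -/
lemma comul_leftAct (f : Dual K C) (x : C) :
    comul (R := K) (leftAct K C f x) = (leftAct K C f).rTensor C (comul x) := by
  have h (t : C ⊗[K] C) : comul (R := K) (leftSlice K C f t) =
      (_root_.TensorProduct.lid K (C ⊗[K] C)) (f.rTensor _ (comul.lTensor C t)) := by
    induction t with
    | zero => simp
    | tmul a b => simp
    | add s t hs ht => simp [hs, ht]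
  rw [leftAct_apply, h, ← coassoc_apply, leftSlice_assoc, ← LinearMap.comp_apply,
    ← LinearMap.rTensor_comp]
  rfl

lemma rightAct_leftAct (f g : Dual K C) (x : C) :
    rightAct K C g (leftAct K C f x) = leftAct K C f (rightAct K C g x) := by
  rw [rightAct_apply, comul_leftAct, rightSlice_rTensor, ← rightAct_apply]

lemma leftAct_leftAct (f g : Dual K C) (x : C) :
    leftAct K C g (leftAct K C f x) = leftAct K C (g ∘ₗ leftAct K C f) x := by
  rw [leftAct_apply, comul_leftAct, leftAct_apply]
  generalize (comul x : C ⊗[K] C) = t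
  induction t with
  | zero => simp
  | tmul a b => simp
  | add s t hs ht => simp [hs, ht]

/-- `Δ ((id ⊗ g) (Δ x)) = (id ⊗ (id ⊗ g) ∘ Δ) (Δ x)`. -/
lemma comul_rightAct (g : Dual K C) (x : C) :
    comul (R := K) (rightAct K C g x) = (rightAct K C g).lTensor C (comul x) := by
  refine ext_leftSlice fun f => ?_
  rw [leftSlice_lTensor, ← leftAct_apply, ← leftAct_apply, rightAct_leftAct]

lemma rightAct_rightAct (f g : Dual K C) (x : C) :
    rightAct K C g (rightAct K C f x) = rightAct K C (g ∘ₗ rightAct K C f) x := by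
  rw [rightAct_apply, comul_rightAct, rightAct_apply]
  generalize (comul x : C ⊗[K] C) = t
  induction t with
  | zero => simp
  | tmul a b => simp
  | add s t hs ht => simp [hs, ht]

variable (K) in
/-- The span of the elements `(f ⊗ id ⊗ g) (Δ² c)`. -/
noncomputable def generated (c : C) : Submodule K C :=
  Submodule.map₂ (leftAct K C) ⊤ (LinearMap.range ((rightAct K C).flip c))

lemma mem_generated_self (c : C) : c ∈ generated K c := by
  have := Submodule.apply_mem_map₂ (leftAct K C) (Submodule.mem_top (x := counit))
    (LinearMap.mem_range_self ((rightAct K C).flip c) counit)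
  simpa [generated] using this

lemma leftAct_mem_generated {c x : C} (hx : x ∈ generated K c) (f : Dual K C) :
    leftAct K C f x ∈ generated K c := by
  suffices generated K c ≤ (generated K c).comap (leftAct K C f) from this hx
  refine Submodule.map₂_le.2 fun f' _ v hv => ?_
  rw [Submodule.mem_comap, leftAct_leftAct]
  exact Submodule.apply_mem_map₂ _ Submodule.mem_top hv

lemma rightAct_mem_generated {c x : C} (hx : x ∈ generated K c) (g : Dual K C) :
    rightAct K C g x ∈ generated K c := by
  suffices generated K c ≤ (generated K c).comap (rightAct K C g) from this hx
  refine Submodule.map₂_le.2 ?_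
  rintro f - _ ⟨g', rfl⟩
  rw [Submodule.mem_comap, rightAct_leftAct, LinearMap.flip_apply, rightAct_rightAct]
  exact Submodule.apply_mem_map₂ _ Submodule.mem_top (LinearMap.mem_range_self _ _)

lemma comul_mem_of_mem_generated {c x : C} (hx : x ∈ generated K c) :
    comul (R := K) x ∈ LinearMap.range
      (_root_.TensorProduct.map (generated K c).subtype (generated K c).subtype) :=
  mem_range_map_subtype_of_slices_mem (leftAct_mem_generated hx) (rightAct_mem_generated hx)

lemma finiteDimensional_map₂_leftAct (V : Submodule K C) [FiniteDimensional K V] :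
    FiniteDimensional K (Submodule.map₂ (leftAct K C) ⊤ V) := by
  obtain ⟨S, hS⟩ := Submodule.fg_iff_finiteDimensional V |>.2 ‹_›
  have hsup : Submodule.map₂ (leftAct K C) ⊤ V =
      S.sup fun s => LinearMap.range ((leftAct K C).flip s) := by
    rw [← hS, Submodule.span_eq_iSup_of_singleton_spans]
    simp only [Submodule.map₂_iSup_right,
      Submodule.map₂_span_singleton_eq_map_flip, Submodule.map_top, Finset.sup_eq_iSup,
      Finset.mem_coe]
  have (s : C) : FiniteDimensional K (LinearMap.range ((leftAct K C).flip s)) :=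
    finiteDimensional_range_leftSlice (comul s)
  rw [hsup]
  infer_instance

instance finiteDimensional_generated (c : C) : FiniteDimensional K (generated K c) := by
  have : FiniteDimensional K (LinearMap.range ((rightAct K C).flip c)) :=
    finiteDimensional_range_rightSlice (comul c)
  exact finiteDimensional_map₂_leftAct _

end Coalgebra

lemma IsSubcoalgebra.sup {C : Type*} [AddCommGroup C] [Module ℂ C] [Coalgebra ℂ C]
    {D₁ D₂ : Submodule ℂ C} (h₁ : IsSubcoalgebra D₁) (h₂ : IsSubcoalgebra D₂) :
    IsSubcoalgebra (D₁ ⊔ D₂) := by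
  intro c hc
  obtain ⟨x, hx, y, hy, rfl⟩ := Submodule.mem_sup.1 hc
  rw [map_add]
  exact add_mem (TensorProduct.range_mapIncl_mono le_sup_left le_sup_left (h₁ x hx))
    (TensorProduct.range_mapIncl_mono le_sup_right le_sup_right (h₂ y hy))

/-- Every coalgebra C over ℂ is the union of its finite-dimensional sub-coalgebras:
every c ∈ C lies in a finite-dimensional sub-coalgebra, and the system of
finite-dimensional sub-coalgebras is directed by inclusion. -/
theorem coalgebra_union_of_finiteDimensional_subcoalgebras
    {C : Type*} [AddCommGroup C] [Module ℂ C] [Coalgebra ℂ C] :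
    (∀ c : C, ∃ D : Submodule ℂ C,
        IsSubcoalgebra D ∧ FiniteDimensional ℂ D ∧ c ∈ D) ∧
    (∀ D₁ D₂ : Submodule ℂ C,
        IsSubcoalgebra D₁ → FiniteDimensional ℂ D₁ →
        IsSubcoalgebra D₂ → FiniteDimensional ℂ D₂ →
        ∃ E : Submodule ℂ C, IsSubcoalgebra E ∧ FiniteDimensional ℂ E ∧
          D₁ ≤ E ∧ D₂ ≤ E) := by
  refine ⟨fun c => ⟨Coalgebra.generated ℂ c, fun _ hx => Coalgebra.comul_mem_of_mem_generated hx,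
    inferInstance, Coalgebra.mem_generated_self c⟩, fun D₁ D₂ h₁ _ h₂ _ => ?_⟩
  exact ⟨D₁ ⊔ D₂, h₁.sup h₂, inferInstance, le_sup_left, le_sup_right⟩
end

section
/- Let (C, Δ, δ) be a coalgebra over ℂ and let K and L be positive semi-definite sesquilinear forms on C (K(c,c) ≥ 0 and L(c,c) ≥ 0 for all c ∈ C). Then their convolution K⋆L, defined by (K⋆L)(c, d) = Σ K(c₍₁₎, d₍₁₎) L(c₍₂₎, d₍₂₎) in Sweedler notation, is again a positive semi-definite sesquilinear form on C. -/
/-!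
The convolution of two positive semi-definite sesquilinear forms on a coalgebra is
positive semi-definite.
-/

open scoped TensorProduct ComplexOrder

/-- `K : C × C → ℂ` is a sesquilinear form: additive in both arguments, conjugate-linear
in the first and linear in the second argument. -/
def IsSesq {C : Type*} [AddCommGroup C] [Module ℂ C] (K : C → C → ℂ) : Prop :=
  (∀ a c d : C, K (a + c) d = K a d + K c d) ∧
  (∀ c a d : C, K c (a + d) = K c a + K c d) ∧
  (∀ (r : ℂ) (c d : C), K (r • c) d = (starRingEnd ℂ) r * K c d) ∧
  (∀ (r : ℂ) (c d : C), K c (r • d) = r * K c d)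

/-- `M` is the convolution K⋆L of the sesquilinear forms `K` and `L`: in Sweedler
notation, (K⋆L)(c,d) = Σ K(c₍₁₎, d₍₁₎) L(c₍₂₎, d₍₂₎). -/
def IsSesqConv {C : Type*} [AddCommGroup C] [Module ℂ C] [Coalgebra ℂ C]
    (K L M : C → C → ℂ) : Prop :=
  ∀ (c d : C) (n m : ℕ) (c₁ c₂ : Fin n → C) (d₁ d₂ : Fin m → C),
    Coalgebra.comul (R := ℂ) c = ∑ i, c₁ i ⊗ₜ[ℂ] c₂ i →
    Coalgebra.comul (R := ℂ) d = ∑ j, d₁ j ⊗ₜ[ℂ] d₂ j →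
    M c d = ∑ i, ∑ j, K (c₁ i) (d₁ j) * L (c₂ i) (d₂ j)

theorem IsSesq.sum_left {C : Type*} [AddCommGroup C] [Module ℂ C] {K : C → C → ℂ}
    (hK : IsSesq K) {ι : Type*} (s : Finset ι) (f : ι → C) (d : C) :
    K (∑ i ∈ s, f i) d = ∑ i ∈ s, K (f i) d :=
  map_sum (AddMonoidHom.mk' (fun c => K c d) fun a c => hK.1 a c d) f s

theorem IsSesq.sum_right {C : Type*} [AddCommGroup C] [Module ℂ C] {K : C → C → ℂ}
    (hK : IsSesq K) {ι : Type*} (s : Finset ι) (c : C) (f : ι → C) :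
    K c (∑ i ∈ s, f i) = ∑ i ∈ s, K c (f i) :=
  map_sum (AddMonoidHom.mk' (K c) fun a d => hK.2.1 c a d) f s

theorem IsSesq.conj_symm {C : Type*} [AddCommGroup C] [Module ℂ C] {K : C → C → ℂ}
    (hK : IsSesq K) (hpos : ∀ c : C, 0 ≤ K c c) (c d : C) :
    (starRingEnd ℂ) (K d c) = K c d := by
  obtain ⟨add_left, add_right, smul_left, smul_right⟩ := hK
  have him : ∀ c : C, (K c c).im = 0 := fun c => ((Complex.nonneg_iff.mp (hpos c)).2).symm
  have h₁ := him (c + d)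
  have h₂ := him (c + Complex.I • d)
  have hc := him c
  have hd := him d
  simp only [add_left, add_right, smul_left, smul_right, Complex.conj_I, Complex.add_im,
    Complex.mul_im, Complex.mul_re, Complex.neg_re, Complex.neg_im, Complex.I_re,
    Complex.I_im] at h₁ h₂
  apply Complex.ext
  · rw [Complex.conj_re]
    linarith
  · rw [Complex.conj_im]
    linarith

/-- The Gram matrix of a positive semi-definite sesquilinear form is positive semi-definite. -/
theorem IsSesq.posSemidef_gram {C : Type*} [AddCommGroup C] [Module ℂ C] {K : C → C → ℂ}
    (hK : IsSesq K) (hpos : ∀ c : C, 0 ≤ K c c) {ι : Type*} [Fintype ι] (v : ι → C) :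
    (Matrix.of fun i j => K (v i) (v j)).PosSemidef := by
  refine .of_dotProduct_mulVec_nonneg
    (Matrix.IsHermitian.ext fun i j => hK.conj_symm hpos (v i) (v j)) fun x => ?_
  convert hpos (∑ i, x i • v i)
  simp only [hK.sum_left, hK.sum_right, hK.2.2.1, hK.2.2.2, dotProduct, Matrix.mulVec,
    Matrix.of_apply, Pi.star_apply, Finset.mul_sum, starRingEnd_apply]
  exact Finset.sum_congr rfl fun i _ => Finset.sum_congr rfl fun j _ => by ring

theorem TensorProduct.exists_eq_sum_fin_tmul {R M N : Type*} [CommSemiring R] [AddCommMonoid M]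
    [AddCommMonoid N] [Module R M] [Module R N] (t : M ⊗[R] N) :
    ∃ (n : ℕ) (x : Fin n → M) (y : Fin n → N), t = ∑ i, x i ⊗ₜ[R] y i := by
  obtain ⟨S, rfl⟩ := TensorProduct.exists_multiset t
  induction S using Quotient.inductionOn with
  | h l =>
    refine ⟨l.length, fun i => (l.get i).1, fun i => (l.get i).2, ?_⟩
    simp [← List.sum_ofFn, ← List.ofFn_getElem_eq_map]

/-- If K and L are positive semi-definite sesquilinear forms on a coalgebra C
(K(c,c) ≥ 0 and L(c,c) ≥ 0 for all c), then their convolution K⋆L is again a positive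
semi-definite sesquilinear form on C. -/
theorem sesqConv_positive {C : Type*} [AddCommGroup C] [Module ℂ C] [Coalgebra ℂ C]
    (K L M : C → C → ℂ) (hK : IsSesq K) (hL : IsSesq L)
    (hKpos : ∀ c : C, 0 ≤ K c c) (hLpos : ∀ c : C, 0 ≤ L c c)
    (hM : IsSesqConv K L M) :
    IsSesq M ∧ ∀ c : C, 0 ≤ M c c := by
  choose n x y hxy using fun c : C =>
    TensorProduct.exists_eq_sum_fin_tmul (Coalgebra.comul (R := ℂ) c)
  refine ⟨⟨fun a c d => ?_, fun c a d => ?_, fun r c d => ?_, fun r c d => ?_⟩, fun c => ?_⟩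
  · rw [hM (a + c) d _ _ (Fin.append (x a) (x c)) (Fin.append (y a) (y c)) _ _ ?_ (hxy d),
      hM _ _ _ _ _ _ _ _ (hxy a) (hxy d), hM _ _ _ _ _ _ _ _ (hxy c) (hxy d)]
    · simp [Fin.sum_univ_add]
    · simp [Fin.sum_univ_add, ← hxy]
  · rw [hM c (a + d) _ _ _ _ (Fin.append (x a) (x d)) (Fin.append (y a) (y d)) (hxy c) ?_,
      hM _ _ _ _ _ _ _ _ (hxy c) (hxy a), hM _ _ _ _ _ _ _ _ (hxy c) (hxy d)]
    · simp [Fin.sum_univ_add, Finset.sum_add_distrib]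
    · simp [Fin.sum_univ_add, ← hxy]
  · rw [hM (r • c) d _ _ (fun i => r • x c i) (y c) _ _ ?_ (hxy d),
      hM _ _ _ _ _ _ _ _ (hxy c) (hxy d)]
    · simp only [hK.2.2.1, Finset.mul_sum, mul_assoc]
    · simp only [map_smul, hxy c, Finset.smul_sum, TensorProduct.smul_tmul']
  · rw [hM c (r • d) _ _ _ _ (fun i => r • x d i) (y d) (hxy c) ?_,
      hM _ _ _ _ _ _ _ _ (hxy c) (hxy d)]
    · simp only [hK.2.2.2, Finset.mul_sum, mul_assoc]
    · simp only [map_smul, hxy d, Finset.smul_sum, TensorProduct.smul_tmul']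
  · rw [hM _ _ _ _ _ _ _ _ (hxy c) (hxy c)]
    have h := ((hK.posSemidef_gram hKpos (x c)).hadamard
      (hL.posSemidef_gram hLpos (y c))).dotProduct_mulVec_nonneg 1
    simpa [dotProduct, Matrix.mulVec] using h
end

section
/- (Schoenberg correspondence for sesquilinear forms.) Let (C, Δ, δ) be a coalgebra over ℂ and let L be a sesquilinear form on C. Then the following are equivalent: (i) L is hermitian and conditionally positive (L(c,c) ≥ 0 for all c ∈ C with δ(c) = 0); (ii) for every t ∈ ℝ with t ≥ 0 the convolution exponential exp_⋆(tL), defined pointwise by (exp_⋆(tL))(c,d) = Σ_{k=0}^∞ tᵏ L^{⋆k}(c,d)/k!, is a positive semi-definite sesquilinear form on C. -/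
/-!
Schoenberg correspondence for sesquilinear forms on a coalgebra (von Waldenfels /
Schürmann): L is hermitian and conditionally positive iff exp_⋆(tL) is positive
semi-definite for all t ≥ 0.
-/

open scoped TensorProduct ComplexOrder

/-- `P` is the k-th convolution power L^{⋆k} of the sesquilinear form `L`, with
L^{⋆0}(c,d) = conj(δ(c))·δ(d) (the unit for the convolution of sesquilinear forms). -/
def IsSesqConvPow {C : Type*} [AddCommGroup C] [Module ℂ C] [Coalgebra ℂ C]
    (L : C → C → ℂ) : ℕ → (C → C → ℂ) → Prop
  | 0, P => P = fun c d =>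
      (starRingEnd ℂ) (Coalgebra.counit (R := ℂ) c) * Coalgebra.counit (R := ℂ) d
  | (k + 1), P => ∃ Q : C → C → ℂ, IsSesqConvPow L k Q ∧ IsSesqConv Q L P

section Comatrix

variable {C : Type*} [AddCommGroup C] [Module ℂ C]

lemma lid_rTensor_sum_tmul {ι M : Type*} [Fintype ι] [DecidableEq ι] [AddCommGroup M] [Module ℂ M]
    {x : ι → C} {f : ι → C →ₗ[ℂ] ℂ} (hf : ∀ k l, f k (x l) = if l = k then 1 else 0)
    (k : ι) (m : ι → M) :
    TensorProduct.lid ℂ M ((f k).rTensor M (∑ i, x i ⊗ₜ[ℂ] m i)) = m k := by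
  simp [hf]

variable [Coalgebra ℂ C]

/-- A square array of elements of a coalgebra that comultiplies like matrix coefficients. -/
structure IsComatrix {ι : Type*} [Fintype ι] [DecidableEq ι] (a : ι → ι → C) : Prop where
  comul_eq : ∀ i j, Coalgebra.comul (R := ℂ) (a i j) = ∑ k, a i k ⊗ₜ[ℂ] a k j
  counit_eq : ∀ i j, Coalgebra.counit (R := ℂ) (a i j) = if i = j then 1 else 0

/-- Every element of a coalgebra lies in a finite-dimensional right coideal. -/
lemma exists_finite_rightCoideal (c : C) :
    ∃ V : Submodule ℂ C, Module.Finite ℂ V ∧ c ∈ V ∧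
      ∀ v ∈ V, Coalgebra.comul (R := ℂ) v ∈ LinearMap.range (V.subtype.rTensor C) := by
  classical
  let B := Module.Basis.ofVectorSpace ℂ C
  obtain ⟨b, hb⟩ := TensorProduct.eq_repr_basis_right B (Coalgebra.comul (R := ℂ) c)
  let V := Submodule.span ℂ (b '' (b.support : Set _))
  have hbV : ∀ i ∈ b.support, b i ∈ V := fun i hi => Submodule.subset_span ⟨i, hi, rfl⟩
  have hc : c ∈ V := by
    have h := congrArg (TensorProduct.rid ℂ C) (Coalgebra.lTensor_counit_comul (R := ℂ) c)
    rw [← hb] at h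
    simp only [Finsupp.sum, map_sum, LinearMap.lTensor_tmul, TensorProduct.rid_tmul,
      one_smul] at h
    rw [← h]
    exact Submodule.sum_mem _ fun i hi => Submodule.smul_mem _ _ (hbV i hi)
  refine ⟨V, Module.Finite.span_of_finite ℂ (b.support.finite_toSet.image _), hc, ?_⟩
  suffices V ≤ (LinearMap.range (V.subtype.rTensor C)).comap (Coalgebra.comul (R := ℂ)) from this
  rw [Submodule.span_le]
  rintro _ ⟨i, hi, rfl⟩
  have key : ∀ (x : C) (u : C ⊗[ℂ] C),
      TensorProduct.rid ℂ _ ((B.coord i).lTensor (C ⊗[ℂ] C)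
        ((TensorProduct.assoc ℂ C C C).symm (x ⊗ₜ u)))
        = x ⊗ₜ TensorProduct.rid ℂ _ ((B.coord i).lTensor C u) := by
    intro x u
    induction u with
    | zero => simp
    | tmul y z => simp
    | add y z hy hz => simp only [TensorProduct.tmul_add, map_add, hy, hz]
  have h := congrArg (fun z => TensorProduct.rid ℂ _ ((B.coord i).lTensor (C ⊗[ℂ] C) z))
    (Coalgebra.coassoc_symm_apply (R := ℂ) c)
  rw [← hb] at h
  simp only [Finsupp.sum, map_sum, LinearMap.lTensor_tmul, LinearMap.rTensor_tmul, key,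
    TensorProduct.rid_tmul, Module.Basis.coord_apply, Module.Basis.repr_self] at h
  simp only [Finsupp.single_apply, ite_smul, one_smul, zero_smul, Finset.sum_ite_eq',
    if_pos (Finset.mem_coe.mp hi)] at h
  change Coalgebra.comul (R := ℂ) (b i) ∈ LinearMap.range (V.subtype.rTensor C)
  rw [← h]
  exact Submodule.sum_mem _ fun j hj => ⟨_, LinearMap.rTensor_tmul C V.subtype _ ⟨b j, hbV j hj⟩⟩

/-- Every element of a coalgebra is a linear combination of the entries of a comatrix. -/
lemma exists_isComatrix (c : C) :
    ∃ (n : ℕ) (a : Fin n → Fin n → C) (γ : Fin n → Fin n → ℂ),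
      IsComatrix a ∧ c = ∑ i, ∑ j, γ i j • a i j := by
  classical
  obtain ⟨V, hfin, hc, hV⟩ := exists_finite_rightCoideal c
  let e := Module.finBasis ℂ V
  choose f hf using fun k => LinearMap.exists_extend (e.coord k)
  have hfe : ∀ k l, f k (e l) = if l = k then 1 else 0 := fun k l => by
    rw [← V.subtype_apply, ← LinearMap.comp_apply, hf k]
    simp [Finsupp.single_apply]
  choose z hz using fun j => hV _ (e j).2
  choose w hw using fun j => TensorProduct.eq_repr_basis_left e (z j)
  have hcomul : ∀ j, Coalgebra.comul (R := ℂ) (e j : C) = ∑ i, (e i : C) ⊗ₜ[ℂ] w j i := by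
    intro j
    rw [← hz j, ← hw j, Finsupp.sum_fintype _ _ (by simp)]
    simp
  refine ⟨_, fun i j => w j i,
    fun i j => Coalgebra.counit (R := ℂ) (e i : C) * e.repr ⟨c, hc⟩ j,
    ⟨fun k j => ?_, fun k j => ?_⟩, ?_⟩
  · have h := Coalgebra.coassoc_apply (R := ℂ) (e j : C)
    rw [hcomul] at h
    simp only [map_sum, LinearMap.rTensor_tmul, LinearMap.lTensor_tmul, hcomul,
      TensorProduct.sum_tmul, TensorProduct.assoc_tmul] at h
    rw [Finset.sum_comm] at h
    simp only [← TensorProduct.tmul_sum] at h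
    have h' := congrArg (fun x => TensorProduct.lid ℂ _ ((f k).rTensor _ x)) h
    simp only [lid_rTensor_sum_tmul hfe] at h'
    exact h'.symm
  · have h := Coalgebra.lTensor_counit_comul (R := ℂ) (e j : C)
    rw [hcomul] at h
    simp only [map_sum, LinearMap.lTensor_tmul] at h
    have h' := congrArg (fun x => TensorProduct.lid ℂ _ ((f k).rTensor _ x)) h
    simp only [lid_rTensor_sum_tmul hfe] at h'
    rw [h']
    simp [hfe, eq_comm]
  · have he : ∀ j, (e j : C) = ∑ i, Coalgebra.counit (R := ℂ) (e i : C) • w j i := by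
      intro j
      have h := congrArg (TensorProduct.lid ℂ C) (Coalgebra.rTensor_counit_comul (R := ℂ) (e j : C))
      rw [hcomul] at h
      simpa using h.symm
    have hsum : ∑ j, e.repr ⟨c, hc⟩ j • (e j : C) = c := by
      simpa only [map_sum, map_smul, Submodule.subtype_apply] using
        congrArg V.subtype (e.sum_repr ⟨c, hc⟩)
    refine hsum.symm.trans ?_
    rw [Finset.sum_comm]
    refine Finset.sum_congr rfl fun j _ => ?_
    conv_lhs => rw [he j, Finset.smul_sum]
    simp [smul_smul, mul_comm]

end Comatrix

section ExpLimit

variable {𝔸 : Type*} [NormedRing 𝔸]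

lemma norm_pow_sub_pow_le_of_norm_le (h1 : ‖(1 : 𝔸)‖ ≤ 1) {a b : 𝔸} {m : ℝ} (hm : 1 ≤ m)
    (ha : ‖a‖ ≤ m) (hb : ‖b‖ ≤ m) (n : ℕ) : ‖a ^ n - b ^ n‖ ≤ n * m ^ n * ‖a - b‖ := by
  have hbn : ∀ k : ℕ, ‖b ^ k‖ ≤ m ^ k := by
    intro k
    induction k with
    | zero => simpa using h1
    | succ k ih =>
      rw [pow_succ, pow_succ]
      exact (norm_mul_le _ _).trans (by gcongr)
  induction n with
  | zero => simp
  | succ n ih =>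
    have h : a ^ (n + 1) - b ^ (n + 1) = a * (a ^ n - b ^ n) + (a - b) * b ^ n := by
      rw [pow_succ', pow_succ']; noncomm_ring
    rw [h]
    calc ‖a * (a ^ n - b ^ n) + (a - b) * b ^ n‖
        ≤ ‖a‖ * ‖a ^ n - b ^ n‖ + ‖a - b‖ * ‖b ^ n‖ :=
          (norm_add_le _ _).trans (add_le_add (norm_mul_le _ _) (norm_mul_le _ _))
      _ ≤ m * (n * m ^ n * ‖a - b‖) + ‖a - b‖ * m ^ (n + 1) := by
          have : ‖b ^ n‖ ≤ m ^ (n + 1) := (hbn n).trans (pow_le_pow_right₀ hm (Nat.le_succ n))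
          gcongr
      _ = ((n + 1 : ℕ) : ℝ) * m ^ (n + 1) * ‖a - b‖ := by push_cast; ring

variable [NormedAlgebra ℝ 𝔸]

/-- Two curves through `1` with the same derivative at `0` have asymptotically equal powers. -/
lemma tendsto_pow_sub_pow_of_hasDerivAt (h1 : ‖(1 : 𝔸)‖ ≤ 1) {S T : ℝ → 𝔸} {x : 𝔸}
    (hS0 : S 0 = 1) (hT0 : T 0 = 1) (hS : HasDerivAt S x 0) (hT : HasDerivAt T x 0) :
    Filter.Tendsto (fun n : ℕ => S (n : ℝ)⁻¹ ^ n - T (n : ℝ)⁻¹ ^ n) Filter.atTop (nhds 0) := by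
  have hinv : Filter.Tendsto (fun n : ℕ => (n : ℝ)⁻¹) Filter.atTop (nhds 0) :=
    tendsto_inv_atTop_nhds_zero_nat
  have bound : ∀ {F : ℝ → 𝔸}, F 0 = 1 → HasDerivAt F x 0 →
      ∀ᶠ n : ℕ in Filter.atTop, ‖F (n : ℝ)⁻¹‖ ≤ Real.exp ((‖x‖ + 1) * (n : ℝ)⁻¹) := by
    intro F hF0 hF
    have h := hinv.eventually ((hasDerivAt_iff_isLittleO.mp hF).def one_pos)
    filter_upwards [h] with n hn
    simp only [sub_zero, hF0, one_mul, Real.norm_eq_abs, abs_inv, Nat.abs_cast] at hn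
    have hpos : (0 : ℝ) ≤ (n : ℝ)⁻¹ := by positivity
    calc ‖F (n : ℝ)⁻¹‖ = ‖(F (n : ℝ)⁻¹ - 1 - (n : ℝ)⁻¹ • x) + (n : ℝ)⁻¹ • x + 1‖ := by
          congr 1; abel
      _ ≤ (n : ℝ)⁻¹ + (n : ℝ)⁻¹ * ‖x‖ + 1 := by
          refine (norm_add₃_le).trans ?_
          rw [norm_smul, Real.norm_of_nonneg hpos]
          gcongr
      _ = (‖x‖ + 1) * (n : ℝ)⁻¹ + 1 := by ring
      _ ≤ _ := Real.add_one_le_exp _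
  have hdiff : Filter.Tendsto (fun n : ℕ => (n : ℝ) * ‖S (n : ℝ)⁻¹ - T (n : ℝ)⁻¹‖)
      Filter.atTop (nhds 0) := by
    have h := (hasDerivAt_iff_isLittleO.mp (hS.sub hT)).comp_tendsto hinv
    have h' := h.norm_norm.tendsto_div_nhds_zero
    refine h'.congr fun n => ?_
    simp [hS0, hT0, div_eq_mul_inv, mul_comm]
  rw [tendsto_zero_iff_norm_tendsto_zero]
  refine squeeze_zero' (Filter.Eventually.of_forall fun _ => norm_nonneg _) ?_
    (by simpa using hdiff.const_mul (Real.exp (‖x‖ + 1)))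
  filter_upwards [bound hS0 hS, bound hT0 hT, Filter.eventually_gt_atTop 0] with n hSn hTn hn
  refine (norm_pow_sub_pow_le_of_norm_le h1 (Real.one_le_exp (by positivity)) hSn hTn n).trans ?_
  have hn' : (n : ℝ) ≠ 0 := by positivity
  rw [← Real.exp_nat_mul, mul_left_comm, mul_inv_cancel₀ hn', mul_one]
  exact le_of_eq (by ring)

/-- A curve through `1` with derivative `x` at `0` satisfies `S (1 / n) ^ n → exp x`. -/
lemma tendsto_pow_exp_of_hasDerivAt [CompleteSpace 𝔸] (h1 : ‖(1 : 𝔸)‖ ≤ 1) {S : ℝ → 𝔸} {x : 𝔸}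
    (hS0 : S 0 = 1) (hS : HasDerivAt S x 0) :
    Filter.Tendsto (fun n : ℕ => S (n : ℝ)⁻¹ ^ n) Filter.atTop (nhds (NormedSpace.exp x)) := by
  have hT : HasDerivAt (fun u : ℝ => NormedSpace.exp (u • x)) x 0 := by
    simpa using hasDerivAt_exp_smul_const x (0 : ℝ)
  have h := (tendsto_pow_sub_pow_of_hasDerivAt h1 hS0 (by simp) hS hT).add_const
    (NormedSpace.exp x)
  rw [zero_add] at h
  refine h.congr' ?_
  filter_upwards [Filter.eventually_gt_atTop 0] with n hn
  let _ : NormedAlgebra ℚ 𝔸 := NormedAlgebra.restrictScalars ℚ ℝ 𝔸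
  have hn' : (n : ℝ) ≠ 0 := by positivity
  rw [← NormedSpace.exp_nsmul, ← Nat.cast_smul_eq_nsmul ℝ, smul_smul, mul_inv_cancel₀ hn', one_smul]
  abel

end ExpLimit

section Sesquilinear

variable {C : Type*} [AddCommGroup C] [Module ℂ C]

/-- Diagonal nonnegativity of a sesquilinear form. -/
def SesqNonneg (K : C →ₗ⋆[ℂ] C →ₗ[ℂ] ℂ) : Prop := ∀ c, 0 ≤ K c c

/-- The rank-one form `(c, d) ↦ conj (f c) * f' d`. -/
noncomputable def sesqProd (f f' : C →ₗ[ℂ] ℂ) : C →ₗ⋆[ℂ] C →ₗ[ℂ] ℂ :=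
  LinearMap.mk₂'ₛₗ _ _ (fun c d => (starRingEnd ℂ) (f c) * f' d)
    (by intros; simp [add_mul]) (by intros; simp [mul_assoc])
    (by intros; simp [mul_add]) (by intros; simp [mul_left_comm])

@[simp] lemma sesqProd_apply (f f' : C →ₗ[ℂ] ℂ) (c d : C) :
    sesqProd f f' c d = (starRingEnd ℂ) (f c) * f' d := rfl

/-- A sesquilinear form with real diagonal is hermitian. -/
lemma apply_eq_conj_of_diag (K : C →ₗ⋆[ℂ] C →ₗ[ℂ] ℂ)
    (h : ∀ c, (starRingEnd ℂ) (K c c) = K c c) (c d : C) :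
    K c d = (starRingEnd ℂ) (K d c) := by
  have h1 := h (c + d)
  have h2 := h (c + Complex.I • d)
  simp only [map_add, LinearMap.add_apply, h c, h d, map_smulₛₗ, LinearMap.smul_apply, smul_eq_mul,
    map_mul, Complex.conj_I, map_neg, RingHom.id_apply, neg_neg] at h1 h2
  have h3 : Complex.I * Complex.I = -1 := Complex.I_mul_I
  linear_combination (-1 / 2 : ℂ) * h1 + (Complex.I / 2) * h2
    + ((K c d) / 2 - (starRingEnd ℂ) (K d c) / 2 + (starRingEnd ℂ) (K c d) / 2 - K d c / 2) * h3

lemma SesqNonneg.posSemidef {K : C →ₗ⋆[ℂ] C →ₗ[ℂ] ℂ} (hK : SesqNonneg K) {ι : Type*} [Fintype ι]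
    (x : ι → C) : (Matrix.of fun i j => K (x i) (x j)).PosSemidef := by
  refine .of_dotProduct_mulVec_nonneg ?_ fun v => ?_
  · ext i j
    exact (apply_eq_conj_of_diag K
      (fun c => Complex.conj_eq_iff_im.mpr (Complex.nonneg_iff.mp (hK c)).2.symm) _ _).symm
  · convert hK (∑ i, v i • x i) using 1
    simp only [dotProduct, Matrix.mulVec, Matrix.of_apply, map_sum, LinearMap.sum_apply,
      map_smulₛₗ, LinearMap.smul_apply, smul_eq_mul, Finset.mul_sum, Pi.star_apply,
      RingHom.id_apply, starRingEnd_apply]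
    rw [Finset.sum_comm]
    exact Finset.sum_congr rfl fun i _ => Finset.sum_congr rfl fun j _ => by ring

lemma SesqNonneg.add {K K' : C →ₗ⋆[ℂ] C →ₗ[ℂ] ℂ} (hK : SesqNonneg K) (hK' : SesqNonneg K') :
    SesqNonneg (K + K') := fun c => add_nonneg (hK c) (hK' c)

lemma SesqNonneg.smul {K : C →ₗ⋆[ℂ] C →ₗ[ℂ] ℂ} (hK : SesqNonneg K) {r : ℝ} (hr : 0 ≤ r) :
    SesqNonneg ((r : ℂ) • K) := fun c =>
  mul_nonneg (Complex.zero_le_real.mpr hr) (hK c)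

lemma sesqNonneg_sesqProd (f : C →ₗ[ℂ] ℂ) : SesqNonneg (sesqProd f f) := fun c => by
  rw [sesqProd_apply, mul_comm, Complex.mul_conj]
  exact Complex.zero_le_real.mpr (Complex.normSq_nonneg _)

/-- The sesquilinear form on `C ⊗ C` with `(c ⊗ c', d ⊗ d') ↦ K c d * L c' d'`. -/
noncomputable def sesqTensor (K L : C →ₗ⋆[ℂ] C →ₗ[ℂ] ℂ) :
    C ⊗[ℂ] C →ₗ⋆[ℂ] C ⊗[ℂ] C →ₗ[ℂ] ℂ :=
  TensorProduct.lift (LinearMap.mk₂'ₛₗ (starRingEnd ℂ) (starRingEnd ℂ)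
    (fun x y => LinearMap.mul' ℂ ℂ ∘ₗ TensorProduct.map (K x) (L y))
    (by intros; ext; simp [add_mul]) (by intros; ext; simp [mul_assoc])
    (by intros; ext; simp [mul_add]) (by intros; ext; simp [mul_left_comm]))

@[simp] lemma sesqTensor_tmul (K L : C →ₗ⋆[ℂ] C →ₗ[ℂ] ℂ) (x y z w : C) :
    sesqTensor K L (x ⊗ₜ y) (z ⊗ₜ w) = K x z * L y w := by
  simp [sesqTensor]

variable [Coalgebra ℂ C]

/-- The unit for the convolution of sesquilinear forms. -/
noncomputable def sesqUnit (C : Type*) [AddCommGroup C] [Module ℂ C] [Coalgebra ℂ C] :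
    C →ₗ⋆[ℂ] C →ₗ[ℂ] ℂ :=
  sesqProd (Coalgebra.counit (R := ℂ)) (Coalgebra.counit (R := ℂ))

/-- The convolution of sesquilinear forms. -/
noncomputable def sesqConv (K L : C →ₗ⋆[ℂ] C →ₗ[ℂ] ℂ) : C →ₗ⋆[ℂ] C →ₗ[ℂ] ℂ :=
  ((sesqTensor K L).comp (Coalgebra.comul (R := ℂ))).compl₂ (Coalgebra.comul (R := ℂ))

/-- The convolution powers of a sesquilinear form. -/
noncomputable def sesqPow (L : C →ₗ⋆[ℂ] C →ₗ[ℂ] ℂ) : ℕ → (C →ₗ⋆[ℂ] C →ₗ[ℂ] ℂ)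
  | 0 => sesqUnit C
  | k + 1 => sesqConv (sesqPow L k) L

lemma sesqConv_apply_of_comul_eq (K L : C →ₗ⋆[ℂ] C →ₗ[ℂ] ℂ) {c d : C} {ι κ : Type*} [Fintype ι]
    [Fintype κ] {c₁ c₂ : ι → C} {d₁ d₂ : κ → C}
    (hc : Coalgebra.comul (R := ℂ) c = ∑ i, c₁ i ⊗ₜ[ℂ] c₂ i)
    (hd : Coalgebra.comul (R := ℂ) d = ∑ j, d₁ j ⊗ₜ[ℂ] d₂ j) :
    sesqConv K L c d = ∑ i, ∑ j, K (c₁ i) (d₁ j) * L (c₂ i) (d₂ j) := by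
  rw [sesqConv, LinearMap.compl₂_apply, LinearMap.comp_apply, hc, hd]
  simp only [map_sum, LinearMap.sum_apply, sesqTensor_tmul]
  exact Finset.sum_comm

lemma isSesqConv_iff (K L : C →ₗ⋆[ℂ] C →ₗ[ℂ] ℂ) (M : C → C → ℂ) :
    IsSesqConv (fun c d => K c d) (fun c d => L c d) M ↔ M = fun c d => sesqConv K L c d := by
  constructor
  · intro h
    funext c d
    obtain ⟨n, c₁, c₂, hc⟩ := TensorProduct.exists_sum_tmul_eq (Coalgebra.comul (R := ℂ) c)
    obtain ⟨m, d₁, d₂, hd⟩ := TensorProduct.exists_sum_tmul_eq (Coalgebra.comul (R := ℂ) d)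
    rw [h c d n m c₁ c₂ d₁ d₂ hc hd, sesqConv_apply_of_comul_eq K L hc hd]
  · rintro rfl c d n m c₁ c₂ d₁ d₂ hc hd
    exact sesqConv_apply_of_comul_eq K L hc hd

lemma isSesqConvPow_iff (L : C →ₗ⋆[ℂ] C →ₗ[ℂ] ℂ) (k : ℕ) (P : C → C → ℂ) :
    IsSesqConvPow (fun c d => L c d) k P ↔ P = fun c d => sesqPow L k c d := by
  induction k generalizing P with
  | zero => rfl
  | succ k ih => simp only [IsSesqConvPow, ih, exists_eq_left, isSesqConv_iff, sesqPow]

lemma sesqNonneg_sesqUnit : SesqNonneg (sesqUnit C) := sesqNonneg_sesqProd _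

lemma SesqNonneg.conv {K L : C →ₗ⋆[ℂ] C →ₗ[ℂ] ℂ} (hK : SesqNonneg K) (hL : SesqNonneg L) :
    SesqNonneg (sesqConv K L) := by
  intro c
  obtain ⟨n, c₁, c₂, hc⟩ := TensorProduct.exists_sum_tmul_eq (Coalgebra.comul (R := ℂ) c)
  rw [sesqConv_apply_of_comul_eq K L hc hc]
  have h := ((hK.posSemidef c₁).hadamard (hL.posSemidef c₂)).dotProduct_mulVec_nonneg 1
  simpa [dotProduct, Matrix.mulVec] using h

lemma SesqNonneg.pow {L : C →ₗ⋆[ℂ] C →ₗ[ℂ] ℂ} (hL : SesqNonneg L) (k : ℕ) :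
    SesqNonneg (sesqPow L k) := by
  induction k with
  | zero => exact sesqNonneg_sesqUnit
  | succ k ih => exact ih.conv hL

/-- Evaluation of sesquilinear forms on two comatrices. -/
noncomputable def sesqMatrix {ι κ : Type*} (a : ι → ι → C) (b : κ → κ → C) :
    (C →ₗ⋆[ℂ] C →ₗ[ℂ] ℂ) →ₗ[ℂ] Matrix (ι × κ) (ι × κ) ℂ where
  toFun K := Matrix.of fun p q => K (a p.1 q.1) (b p.2 q.2)
  map_add' _ _ := by ext; simp
  map_smul' _ _ := by ext; simp

/-- Evaluation of sesquilinear forms at a pair factors through a finite-dimensional matrix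
representation of the convolution algebra. -/
lemma exists_matrix_representation (c d : C) :
    ∃ (n m : ℕ) (ρ : (C →ₗ⋆[ℂ] C →ₗ[ℂ] ℂ) →ₗ[ℂ] Matrix (Fin n × Fin m) (Fin n × Fin m) ℂ)
      (φ : Matrix (Fin n × Fin m) (Fin n × Fin m) ℂ →ₗ[ℂ] ℂ),
      ρ (sesqUnit C) = 1 ∧ (∀ K L, ρ (sesqConv K L) = ρ K * ρ L) ∧ ∀ K, K c d = φ (ρ K) := by
  obtain ⟨n, a, γ, ha, hc⟩ := exists_isComatrix c
  obtain ⟨m, b, η, hb, hd⟩ := exists_isComatrix d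
  refine ⟨n, m, sesqMatrix a b,
    ∑ k, ∑ l, ∑ i, ∑ j, (η k l * (starRingEnd ℂ) (γ i j)) • Matrix.entryLinearMap ℂ ℂ (i, k) (j, l),
    ?_, fun K L => ?_, fun K => ?_⟩
  · ext p q
    by_cases h1 : p.1 = q.1 <;> by_cases h2 : p.2 = q.2 <;>
      simp [sesqMatrix, sesqUnit, ha.counit_eq, hb.counit_eq, Matrix.one_apply, Prod.ext_iff, h1, h2]
  · ext p q
    simp [sesqMatrix, sesqConv_apply_of_comul_eq K L (ha.comul_eq _ _) (hb.comul_eq _ _),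
      Matrix.mul_apply, Fintype.sum_prod_type]
  · conv_lhs => rw [hc, hd]
    simp only [map_sum, LinearMap.sum_apply, map_smulₛₗ, LinearMap.smul_apply, smul_eq_mul,
      RingHom.id_apply, Matrix.entryLinearMap_apply, sesqMatrix, LinearMap.coe_mk, AddHom.coe_mk,
      Matrix.of_apply, Finset.mul_sum, mul_assoc]

lemma map_sesqPow {A : Type*} [Ring A] [Module ℂ A] {ρ : (C →ₗ⋆[ℂ] C →ₗ[ℂ] ℂ) →ₗ[ℂ] A}
    (h1 : ρ (sesqUnit C) = 1) (hmul : ∀ K L, ρ (sesqConv K L) = ρ K * ρ L)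
    (L : C →ₗ⋆[ℂ] C →ₗ[ℂ] ℂ) (k : ℕ) : ρ (sesqPow L k) = ρ L ^ k := by
  induction k with
  | zero => simpa [sesqPow] using h1
  | succ k ih => rw [sesqPow, hmul, ih, pow_succ]

/-- A conditionally positive hermitian form is, nonnegative up to terms
`conj δ ⊗ ψ + conj ψ ⊗ δ`. -/
lemma exists_sesqNonneg_sub (L : C →ₗ⋆[ℂ] C →ₗ[ℂ] ℂ)
    (hherm : ∀ c d, L c d = (starRingEnd ℂ) (L d c))
    (hpos : ∀ c : C, Coalgebra.counit (R := ℂ) c = 0 → 0 ≤ L c c) :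
    ∃ ψ : C →ₗ[ℂ] ℂ, SesqNonneg (L - sesqProd (Coalgebra.counit (R := ℂ)) ψ
      - sesqProd ψ (Coalgebra.counit (R := ℂ))) := by
  by_cases h : ∃ e : C, Coalgebra.counit (R := ℂ) e = 1
  · obtain ⟨e, he⟩ := h
    refine ⟨L e - (L e e / 2) • Coalgebra.counit (R := ℂ), fun c => ?_⟩
    have h := hpos (c - Coalgebra.counit (R := ℂ) c • e) (by simp [he])
    convert h using 1
    have hre : (starRingEnd ℂ) (L e e) = L e e := (hherm e e).symm
    simp only [LinearMap.sub_apply, sesqProd_apply, LinearMap.smul_apply, smul_eq_mul, map_sub,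
      map_mul, map_smulₛₗ, RingHom.id_apply, map_div₀, hre, ← hherm c e, map_ofNat]
    ring
  · refine ⟨0, fun c => ?_⟩
    have h0 : Coalgebra.counit (R := ℂ) c = 0 := by
      by_contra hne
      exact h ⟨(Coalgebra.counit (R := ℂ) c)⁻¹ • c, by simp [hne]⟩
    simpa [h0] using hpos c h0

/-- A second-order perturbation of `1 + h L` that is nonnegative for all `h ≥ 0`. -/
lemma exists_sesqNonneg_unit_add (L : C →ₗ⋆[ℂ] C →ₗ[ℂ] ℂ)
    (hherm : ∀ c d, L c d = (starRingEnd ℂ) (L d c))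
    (hpos : ∀ c : C, Coalgebra.counit (R := ℂ) c = 0 → 0 ≤ L c c) :
    ∃ R : C →ₗ⋆[ℂ] C →ₗ[ℂ] ℂ, ∀ h : ℝ, 0 ≤ h →
      SesqNonneg (sesqUnit C + (h : ℂ) • L + ((h ^ 2 : ℝ) : ℂ) • R) := by
  obtain ⟨ψ, hψ⟩ := exists_sesqNonneg_sub L hherm hpos
  refine ⟨sesqProd ψ ψ, fun h hh => ?_⟩
  convert (sesqNonneg_sesqProd (Coalgebra.counit (R := ℂ) + (h : ℂ) • ψ)).add (hψ.smul hh) using 1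
  ext c d
  simp [sesqUnit]
  ring

end Sesquilinear

section Schoenberg

open scoped Matrix.Norms.Operator

variable {C : Type*} [AddCommGroup C] [Module ℂ C] [Coalgebra ℂ C]

lemma Matrix.norm_one_le_one {ι : Type*} [Fintype ι] [DecidableEq ι] :
    ‖(1 : Matrix ι ι ℂ)‖ ≤ 1 := by
  cases isEmpty_or_nonempty ι
  · simp [Subsingleton.elim (1 : Matrix ι ι ℂ) 0]
  · exact norm_one.le

lemma hasSum_pow_mul_map_pow {ι : Type*} [Fintype ι] [DecidableEq ι]
    (φ : Matrix ι ι ℂ →ₗ[ℂ] ℂ) (M : Matrix ι ι ℂ) (t : ℝ) :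
    HasSum (fun k : ℕ => (((t ^ k : ℝ) : ℂ) / (k.factorial : ℂ)) * φ (M ^ k))
      (φ (NormedSpace.exp ((t : ℂ) • M))) := by
  have h := (NormedSpace.exp_series_hasSum_exp' (𝕂 := ℂ) ((t : ℂ) • M)).map φ
    φ.continuous_of_finiteDimensional
  refine h.congr_fun fun k => ?_
  simp [smul_pow, div_eq_inv_mul, mul_assoc]

/-- The exponential series of a sesquilinear form converges pointwise. -/
lemma exists_hasSum_sesqPow (L : C →ₗ⋆[ℂ] C →ₗ[ℂ] ℂ) (t : ℝ) (c d : C) :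
    ∃ s : ℂ, HasSum (fun k : ℕ => (((t ^ k : ℝ) : ℂ) / (k.factorial : ℂ)) * sesqPow L k c d) s := by
  obtain ⟨n, m, ρ, φ, h1, hmul, hφ⟩ := exists_matrix_representation c d
  refine ⟨_, (hasSum_pow_mul_map_pow φ (ρ L) t).congr_fun fun k => ?_⟩
  rw [hφ, map_sesqPow h1 hmul]

lemma nonneg_of_hasSum_sesqPow (L : C →ₗ⋆[ℂ] C →ₗ[ℂ] ℂ)
    (hherm : ∀ c d, L c d = (starRingEnd ℂ) (L d c))
    (hpos : ∀ c : C, Coalgebra.counit (R := ℂ) c = 0 → 0 ≤ L c c) {t : ℝ} (ht : 0 ≤ t) (c : C)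
    {s : ℂ} (hs : HasSum
      (fun k : ℕ => (((t ^ k : ℝ) : ℂ) / (k.factorial : ℂ)) * sesqPow L k c c) s) : 0 ≤ s := by
  obtain ⟨n, m, ρ, φ, h1, hmul, hφ⟩ := exists_matrix_representation c c
  obtain ⟨R, hR⟩ := exists_sesqNonneg_unit_add L hherm hpos
  have hs' : s = φ (NormedSpace.exp ((t : ℂ) • ρ L)) := by
    refine hs.unique ((hasSum_pow_mul_map_pow φ (ρ L) t).congr_fun fun k => ?_)
    rw [hφ, map_sesqPow h1 hmul]
  let F : ℝ → (C →ₗ⋆[ℂ] C →ₗ[ℂ] ℂ) := fun u =>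
    sesqUnit C + ((u * t : ℝ) : ℂ) • L + (((u * t) ^ 2 : ℝ) : ℂ) • R
  have hF : ∀ u, ρ (F u) = 1 + (u * t) • ρ L + ((u * t) ^ 2) • ρ R := fun u => by
    simp only [F, map_add, map_smul, h1, Complex.coe_smul]
  have hderiv : HasDerivAt (fun u => ρ (F u)) ((t : ℂ) • ρ L) 0 := by
    simp only [hF]
    have hu : HasDerivAt (fun u : ℝ => u * t) t 0 := by
      simpa using (hasDerivAt_id (0 : ℝ)).mul_const t
    have h := ((hu.smul_const (ρ L)).const_add 1).add ((hu.pow 2).smul_const (ρ R))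
    exact h.congr_deriv (by simp)
  have hlim := tendsto_pow_exp_of_hasDerivAt Matrix.norm_one_le_one (by simp [hF]) hderiv
  have hlim' := (φ.continuous_of_finiteDimensional.tendsto _).comp hlim
  rw [hs']
  refine ge_of_tendsto' hlim' fun k => ?_
  simp only [Function.comp_apply]
  rw [← map_sesqPow h1 hmul, ← hφ]
  exact (hR _ (by positivity)).pow k c

/-- The derivative at `0` of the convolution exponential of `t • L` is `L`. -/
lemma tendsto_slope_of_hasSum_sesqPow (L : C →ₗ⋆[ℂ] C →ₗ[ℂ] ℂ) (c d : C) {E : ℝ → ℂ}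
    (hE : ∀ t, 0 < t → HasSum
      (fun k : ℕ => (((t ^ k : ℝ) : ℂ) / (k.factorial : ℂ)) * sesqPow L k c d) (E t)) :
    Filter.Tendsto (fun t : ℝ => t⁻¹ • (E t - sesqUnit C c d)) (nhdsWithin 0 (Set.Ioi 0))
      (nhds (L c d)) := by
  obtain ⟨n, m, ρ, φ, h1, hmul, hφ⟩ := exists_matrix_representation c d
  have hd : HasDerivAt (fun u : ℝ => φ (NormedSpace.exp (u • ρ L))) (φ (ρ L)) 0 := by
    have h := hasDerivAt_exp_smul_const (ρ L) (0 : ℝ)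
    simp only [zero_smul, NormedSpace.exp_zero, one_mul] at h
    exact ((φ.toContinuousLinearMap.restrictScalars ℝ).hasFDerivAt.comp_hasDerivAt (0 : ℝ) h)
  have h := hd.tendsto_slope_zero_right
  rw [hφ L]
  refine h.congr' ?_
  filter_upwards [self_mem_nhdsWithin] with t ht
  have hEt : E t = φ (NormedSpace.exp ((t : ℂ) • ρ L)) := by
    refine (hE t ht).unique ((hasSum_pow_mul_map_pow φ (ρ L) t).congr_fun fun k => ?_)
    rw [hφ, map_sesqPow h1 hmul]
  simp [hEt, hφ, h1]

/-- A form whose convolution exponentials are nonnegative is hermitian and conditionally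
positive. -/
lemma hermitian_and_condPos_of_exp_nonneg (L : C →ₗ⋆[ℂ] C →ₗ[ℂ] ℂ)
    (h : ∀ t : ℝ, 0 < t → ∀ c s, HasSum
      (fun k : ℕ => (((t ^ k : ℝ) : ℂ) / (k.factorial : ℂ)) * sesqPow L k c c) s → 0 ≤ s) :
    (∀ c d, L c d = (starRingEnd ℂ) (L d c)) ∧
      ∀ c : C, Coalgebra.counit (R := ℂ) c = 0 → 0 ≤ L c c := by
  choose E hE using exists_hasSum_sesqPow L
  have hEpos : ∀ t, 0 < t → ∀ c, 0 ≤ E t c c := fun t ht c => h t ht c _ (hE t c c)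
  have hlim := fun c => tendsto_slope_of_hasSum_sesqPow L c c (fun t _ => hE t c c)
  constructor
  · refine apply_eq_conj_of_diag L fun c => Complex.conj_eq_iff_im.mpr ?_
    refine tendsto_nhds_unique ((Complex.continuous_im.tendsto _).comp (hlim c))
      (tendsto_const_nhds.congr' ?_)
    filter_upwards [self_mem_nhdsWithin] with t ht
    have h1 := (Complex.nonneg_iff.mp (hEpos t ht c)).2
    have h2 := (Complex.nonneg_iff.mp (sesqNonneg_sesqUnit c)).2
    simp [← h1, ← h2]
  · intro c hc
    refine ge_of_tendsto (hlim c) ?_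
    filter_upwards [self_mem_nhdsWithin] with t ht
    have h0 : sesqUnit C c c = 0 := by simp [sesqUnit, hc]
    rw [h0, sub_zero]
    exact smul_nonneg (inv_nonneg.mpr (le_of_lt ht)) (hEpos t ht c)

end Schoenberg

/-- **Schoenberg correspondence for sesquilinear forms.**  For a sesquilinear form L on
a coalgebra C the following are equivalent:
(i) L is hermitian and conditionally positive (L(c,c) ≥ 0 whenever δ(c) = 0);
(ii) for every t ≥ 0 the convolution exponential exp_⋆(tL), defined pointwise by the
series (exp_⋆(tL))(c,d) = Σ_k tᵏL^{⋆k}(c,d)/k!, is a positive semi-definite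
sesquilinear form:  the series converges for all c, d and its diagonal limits are
nonnegative. -/
theorem schoenberg_correspondence_sesquilinear
    {C : Type*} [AddCommGroup C] [Module ℂ C] [Coalgebra ℂ C]
    (L : C → C → ℂ)
    (hL : (∀ a c d : C, L (a + c) d = L a d + L c d) ∧
      (∀ c a d : C, L c (a + d) = L c a + L c d) ∧
      (∀ (r : ℂ) (c d : C), L (r • c) d = (starRingEnd ℂ) r * L c d) ∧
      (∀ (r : ℂ) (c d : C), L c (r • d) = r * L c d)) :
    ((∀ c d : C, L c d = (starRingEnd ℂ) (L d c)) ∧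
        (∀ c : C, Coalgebra.counit (R := ℂ) c = 0 → 0 ≤ L c c))
      ↔
    (∀ t : ℝ, 0 ≤ t → ∀ P : ℕ → (C → C → ℂ), (∀ k, IsSesqConvPow L k (P k)) →
      (∀ c d : C, ∃ s : ℂ, Filter.Tendsto
          (fun N : ℕ => ∑ k ∈ Finset.range N,
            (((t ^ k : ℝ) : ℂ) / (k.factorial : ℂ)) * P k c d)
          Filter.atTop (nhds s)) ∧
      (∀ c : C, ∀ s : ℂ, Filter.Tendsto
          (fun N : ℕ => ∑ k ∈ Finset.range N,
            (((t ^ k : ℝ) : ℂ) / (k.factorial : ℂ)) * P k c c)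
          Filter.atTop (nhds s) → 0 ≤ s)) := by
  let Λ : C →ₗ⋆[ℂ] C →ₗ[ℂ] ℂ := LinearMap.mk₂'ₛₗ _ _ L hL.1 hL.2.2.1 hL.2.1 hL.2.2.2
  have hpow : ∀ P : ℕ → C → C → ℂ,
      (∀ k, IsSesqConvPow L k (P k)) ↔ ∀ k, P k = fun c d => sesqPow Λ k c d :=
    fun P => forall_congr' fun k => isSesqConvPow_iff Λ k (P k)
  simp only [hpow]
  constructor
  · rintro ⟨hherm, hpos⟩ t ht P hP
    simp only [hP]
    have hsum := exists_hasSum_sesqPow Λ t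
    refine ⟨fun c d => (hsum c d).imp fun s hs => hs.tendsto_sum_nat, fun c s hs => ?_⟩
    obtain ⟨s', hs'⟩ := hsum c c
    rw [tendsto_nhds_unique hs hs'.tendsto_sum_nat]
    exact nonneg_of_hasSum_sesqPow Λ hherm hpos ht c hs'
  · intro h
    exact hermitian_and_condPos_of_exp_nonneg Λ fun t ht c s hs =>
      (h t ht.le (fun k c d => sesqPow Λ k c d) fun _ => rfl).2 c s hs.tendsto_sum_nat
end
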